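/- arXiv:2604.26950 — 10 statements merged into one kernel-verified Lean document; each statement's English description precedes it below -/
import Mathlib

section
/- Let K be a field of characteristic zero, n a natural number, and w a weighting of K^n. Let X be a K-linear derivation of R = MvPowerSeries (Fin n) K that is w-admissible, with weighted linear approximation components P^i ∈ MvPolynomial (Fin n) K. Let A : Matrix (Fin n) (Fin n) K be the matrix with A i j = (coefficient of e_j in P^i). Suppose there exists λ : Fin n → K such that (1) for every value c attained by w, the characteristic polynomial of the square submatrix of A on the index set {i : w i = c} equals the product over {i : w i = c} of (T − λ i), and (2) λ is non-resonant with respect to w: for every i and every finitely supported α : Fin n → ℕ with ⟨w,α⟩ > w i, one has Σ_j (α j) · (λ j) ≠ λ i (computed in K). Then there exists a K-algebra automorphism φ of R such that for every i, φ(X(φ⁻¹(x^i))) = P^i (the polynomial P^i viewed in R); that is, the pullback φ*X = φ∘X∘φ⁻¹ agrees with the weighted linear approximation of X on the generators. -/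
namespace Module.End

section ApproximateEigenvectors

open Polynomial

variable {K V : Type*} [Field K] [AddCommGroup V] [Module K V]
  {T : Module.End K V} {E : Set K} {N : Submodule K V} {u v : V}

/-- `IsGenEigen T E N v` says that `v` is annihilated modulo `N` by a product of operators `T - μ`
with `μ ∈ E`. -/
inductive IsGenEigen (T : Module.End K V) (E : Set K) (N : Submodule K V) : V → Prop
  | of_mem {v : V} (hv : v ∈ N) : IsGenEigen T E N v
  | of_sub {v : V} (μ : K) (hμ : μ ∈ E) (hv : IsGenEigen T E N (T v - μ • v)) : IsGenEigen T E N v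

namespace IsGenEigen

theorem zero : IsGenEigen T E N 0 := of_mem N.zero_mem

theorem map {S : Module.End K V} (hS : Commute S T) (hN : ∀ v ∈ N, S v ∈ N)
    (hv : IsGenEigen T E N v) : IsGenEigen T E N (S v) := by
  induction hv with
  | of_mem hv => exact of_mem (hN _ hv)
  | @of_sub v μ hμ _ ih =>
    refine of_sub μ hμ ?_
    have : S (T v) = T (S v) := LinearMap.congr_fun hS v
    simpa [this] using ih

theorem smul (c : K) (hv : IsGenEigen T E N v) : IsGenEigen T E N (c • v) := by
  simpa using hv.map (S := algebraMap K _ c) (Algebra.commutes c T)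
    (fun v hv => N.smul_mem c hv)

theorem aeval (hN : ∀ v ∈ N, T v ∈ N) (hv : IsGenEigen T E N v) (p : K[X]) :
    IsGenEigen T E N (Polynomial.aeval T p v) := by
  refine hv.map ?_ fun v hv => Polynomial.aeval_apply_smul_mem_of_le_comap hv p T hN
  simpa using (Commute.all p X).map (Polynomial.aeval T)

theorem add (hN : ∀ v ∈ N, T v ∈ N) (hu : IsGenEigen T E N u) (hv : IsGenEigen T E N v) :
    IsGenEigen T E N (u + v) := by
  induction hu generalizing v with
  | @of_mem u hu =>
    induction hv generalizing u with
    | of_mem hv => exact of_mem (N.add_mem hu hv)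
    | @of_sub v μ hμ _ ih =>
      refine of_sub μ hμ ?_
      have : T (u + v) - μ • (u + v) = T u - μ • u + (T v - μ • v) := by
        rw [map_add, smul_add]; abel
      rw [this]
      exact ih (N.sub_mem (hN u hu) (N.smul_mem μ hu))
  | @of_sub u μ hμ _ ih =>
    refine of_sub μ hμ ?_
    have : T (u + v) - μ • (u + v) = T u - μ • u + (T v - μ • v) := by
      rw [map_add, smul_add]; abel
    rw [this]
    refine ih ?_
    have h := hv.aeval hN (X - C μ)
    rwa [map_sub, aeval_X, aeval_C, LinearMap.sub_apply, Module.algebraMap_end_apply] at h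

theorem sum {ι : Type*} (hN : ∀ v ∈ N, T v ∈ N) (s : Finset ι) (f : ι → V)
    (hf : ∀ i ∈ s, IsGenEigen T E N (f i)) : IsGenEigen T E N (∑ i ∈ s, f i) :=
  Finset.sum_induction f _ (fun _ _ => add hN) zero hf

theorem of_aeval_prod {ι : Type*} (s : Finset ι) (l : ι → K) (hl : ∀ i ∈ s, l i ∈ E)
    (hv : IsGenEigen T E N (Polynomial.aeval T (∏ i ∈ s, (X - C (l i))) v)) :
    IsGenEigen T E N v := by
  classical
  induction s using Finset.induction_on generalizing v with
  | empty => simpa using hv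
  | insert i s hi ih =>
    refine of_sub (l i) (hl i (Finset.mem_insert_self i s)) ?_
    refine ih (fun j hj => hl j (Finset.mem_insert_of_mem hj)) ?_
    rw [Finset.prod_insert hi, mul_comm] at hv
    simpa using hv

/-- If `μ` is not among the approximate eigenvalues of `v`, then `T - μ` reaches `v` modulo `N`. -/
theorem exists_sub_mem {μ : K} (hμ : μ ∉ E) {M : Submodule K V} (hM : ∀ v ∈ M, T v ∈ M)
    (hv : IsGenEigen T E N v) (hvM : v ∈ M) : ∃ u ∈ M, v - (T u - μ • u) ∈ N := by
  induction hv with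
  | of_mem hv => exact ⟨0, M.zero_mem, by simpa using hv⟩
  | @of_sub v ν hν _ ih =>
    obtain ⟨u, hu, huN⟩ := ih (M.sub_mem (hM v hvM) (M.smul_mem ν hvM))
    have hne : μ - ν ≠ 0 := sub_ne_zero.2 fun h => hμ (h ▸ hν)
    refine ⟨(μ - ν)⁻¹ • (u - v), M.smul_mem _ (M.sub_mem hu hvM), ?_⟩
    have : v - (T ((μ - ν)⁻¹ • (u - v)) - μ • (μ - ν)⁻¹ • (u - v)) =
        (μ - ν)⁻¹ • (T v - ν • v - (T u - μ • u)) := by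
      rw [eq_inv_smul_iff₀ hne, map_smul, smul_comm μ, ← smul_sub, smul_sub, smul_inv_smul₀ hne,
        map_sub]
      module
    rw [this]
    exact N.smul_mem _ huN

end IsGenEigen

end ApproximateEigenvectors

section PolynomialMatrixAction

open Polynomial

variable {K V m : Type*} [Field K] [AddCommGroup V] [Module K V] [Fintype m]
  (T : Module.End K V)

/-- The action of polynomial matrices on vectors with entries in `V`, the variable acting by `T`. -/
noncomputable def polyMatrixAct (M : Matrix m m K[X]) (v : m → V) : m → V :=
  fun i => ∑ j, aeval T (M i j) (v j)

theorem polyMatrixAct_mul (M M' : Matrix m m K[X]) (v : m → V) :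
    polyMatrixAct T (M * M') v = polyMatrixAct T M (polyMatrixAct T M' v) := by
  ext i
  simp only [polyMatrixAct, Matrix.mul_apply, map_sum, map_mul, LinearMap.sum_apply,
    Module.End.mul_apply]
  exact Finset.sum_comm

variable [DecidableEq m]

theorem polyMatrixAct_smul_one (p : K[X]) (v : m → V) :
    polyMatrixAct T (p • (1 : Matrix m m K[X])) v = fun i => aeval T p (v i) := by
  ext i
  rw [polyMatrixAct, Finset.sum_eq_single i]
  · simp
  · intro j _ hj
    simp [Matrix.one_apply_ne hj.symm]
  · simp

theorem polyMatrixAct_charmatrix (B : Matrix m m K) (v : m → V) :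
    polyMatrixAct T B.charmatrix v = fun i => T (v i) - ∑ j, B i j • v j := by
  ext i
  simp only [polyMatrixAct, Matrix.charmatrix_apply, map_sub, LinearMap.sub_apply,
    Finset.sum_sub_distrib, aeval_C, Module.algebraMap_end_apply]
  congr 1
  rw [Finset.sum_eq_single i]
  · simp
  · intro j _ hj
    simp [Matrix.diagonal_apply_ne _ hj.symm]
  · simp

theorem aeval_charpoly_apply (B : Matrix m m K) (v : m → V) (i : m) :
    aeval T B.charpoly (v i) =
      ∑ j, aeval T (B.charmatrix.adjugate i j) (T (v j) - ∑ k, B j k • v k) := by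
  have h := polyMatrixAct_mul T B.charmatrix.adjugate B.charmatrix v
  rw [Matrix.adjugate_mul, polyMatrixAct_smul_one, polyMatrixAct_charmatrix] at h
  exact congrFun h i

/-- A linear system `T v - B v = r` is solvable once `r` is in the range of the characteristic
polynomial of `B` evaluated at `T`. -/
theorem exists_map_sub_sum_smul_eq (B : Matrix m m K) {M : Submodule K V}
    (hM : ∀ v ∈ M, T v ∈ M) (r : m → V) (hr : ∀ i, ∃ u ∈ M, aeval T B.charpoly u = r i) :
    ∃ v : m → V, (∀ i, v i ∈ M) ∧ ∀ i, T (v i) - ∑ j, B i j • v j = r i := by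
  choose u hu hur using hr
  refine ⟨polyMatrixAct T B.charmatrix.adjugate u, fun i => Submodule.sum_mem _ fun j _ =>
    aeval_apply_smul_mem_of_le_comap (hu j) _ T hM, fun i => ?_⟩
  have h := polyMatrixAct_mul T B.charmatrix B.charmatrix.adjugate u
  rw [Matrix.mul_adjugate, polyMatrixAct_smul_one, polyMatrixAct_charmatrix] at h
  exact (congrFun h i).symm.trans (hur i)

end PolynomialMatrixAction

end Module.End

namespace MvPowerSeries

open Finsupp (weight single)

section WeightFiltration

variable {K σ : Type*} [Field K]

/-- The power series all of whose monomials have `w`-weight at least `k`. -/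
def weightFiltration (K : Type*) {σ : Type*} [Field K] (w : σ → ℕ) (k : ℕ) :
    Submodule K (MvPowerSeries σ K) where
  carrier := {f | ∀ α, weight w α < k → coeff α f = 0}
  add_mem' hf hg α hα := by simp [hf α hα, hg α hα]
  zero_mem' α _ := by simp
  smul_mem' c f hf α hα := by simp [hf α hα]

variable {w : σ → ℕ} {k m : ℕ} {f g : MvPowerSeries σ K}

theorem weightFiltration_antitone (h : k ≤ m) (hf : f ∈ weightFiltration K w m) :
    f ∈ weightFiltration K w k := fun α hα => hf α (hα.trans_le h)

theorem mem_weightFiltration_zero : f ∈ weightFiltration K w 0 := fun _ hα => by omega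

theorem eq_zero_of_forall_mem_weightFiltration (h : ∀ k, f ∈ weightFiltration K w k) : f = 0 := by
  ext α
  exact h (weight w α + 1) α (Nat.lt_succ_self _)

theorem mul_mem_weightFiltration (hf : f ∈ weightFiltration K w k)
    (hg : g ∈ weightFiltration K w m) : f * g ∈ weightFiltration K w (k + m) := by
  classical
  intro α hα
  rw [coeff_mul]
  refine Finset.sum_eq_zero fun p hp => ?_
  rw [← Finset.HasAntidiagonal.mem_antidiagonal.1 hp, map_add] at hα
  by_cases h : weight w p.1 < k
  · rw [hf _ h, zero_mul]
  · rw [hg _ (by omega), mul_zero]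

theorem monomial_mem_weightFiltration (α : σ →₀ ℕ) (c : K) :
    monomial α c ∈ weightFiltration K w (weight w α) := by
  classical
  intro β hβ
  rw [coeff_monomial, if_neg]
  rintro rfl
  exact lt_irrefl _ hβ

theorem X_mem_weightFiltration (i : σ) :
    (X i : MvPowerSeries σ K) ∈ weightFiltration K w (w i) := by
  simpa [Finsupp.weight_single, X] using
    monomial_mem_weightFiltration (K := K) (w := w) (single i 1) 1

theorem coe_eq_sum_smul_monomial (p : MvPolynomial σ K) :
    (p : MvPowerSeries σ K) = ∑ α ∈ p.support, p.coeff α • monomial α (1 : K) := by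
  classical
  ext β
  simp [coeff_monomial]

theorem coe_mem_weightFiltration {p : MvPolynomial σ K} (hp : ∀ α ∈ p.support, k ≤ weight w α) :
    (p : MvPowerSeries σ K) ∈ weightFiltration K w k := by
  intro α hα
  rw [MvPolynomial.coeff_coe]
  by_contra h
  have := hp α (MvPolynomial.mem_support_iff.2 h)
  omega

theorem aeval_congr_of_mem_support {S : Type*} [CommRing S] [Algebra K S] {y z : σ → S}
    {p : MvPolynomial σ K} (h : ∀ α ∈ p.support, ∀ i, α i ≠ 0 → y i = z i) :
    MvPolynomial.aeval y p = MvPolynomial.aeval z p := by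
  refine MvPolynomial.eval₂Hom_congr' rfl (fun i hi _ => ?_) rfl
  obtain ⟨α, hα, hiα⟩ := (MvPolynomial.mem_vars_iff_mem_support i).1 hi
  exact h α hα i (Finsupp.mem_support_iff.1 hiα)

theorem algHom_coe_eq_aeval (ψ : MvPowerSeries σ K →ₐ[K] MvPowerSeries σ K)
    (p : MvPolynomial σ K) : ψ p = MvPolynomial.aeval (fun i => ψ (X i)) p := by
  have : ψ.comp (MvPolynomial.coeToMvPowerSeries.algHom K) =
      MvPolynomial.aeval fun i => ψ (X i) := by
    ext i
    simp
  simpa using DFunLike.congr_fun this p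

theorem sub_C_constantCoeff_mem_weightFiltration [Finite σ] (hw : ∀ i, w i ≠ 0) :
    f - C (constantCoeff f) ∈ weightFiltration K w 1 := by
  have : Finsupp.NonTorsionWeight ℕ w := Finsupp.nonTorsionWeight_of ℕ w hw
  intro α hα
  obtain rfl := (Finsupp.weight_eq_zero_iff_eq_zero w).1 (Nat.lt_one_iff.1 hα)
  simp

/-- A power series without constant term is a combination of the variables, with coefficients in
the expected steps of the weight filtration. -/
theorem exists_eq_sum_X_mul [Fintype σ] (hk : 1 ≤ k) (hf : f ∈ weightFiltration K w k) :
    ∃ g : σ → MvPowerSeries σ K,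
      (∀ i, g i ∈ weightFiltration K w (k - w i)) ∧ f = ∑ i, X i * g i := by
  classical
  have hsplit : ∀ β : σ →₀ ℕ, ∃ e : σ → K, β ≠ 0 → (∀ i, β i = 0 → e i = 0) ∧ ∑ i, e i = 1 := by
    intro β
    by_cases hβ : β = 0
    · exact ⟨0, fun h => absurd hβ h⟩
    · obtain ⟨i, hi⟩ := Finsupp.ne_iff.1 hβ
      refine ⟨Pi.single i 1, fun _ => ⟨fun j hj => ?_, by simp⟩⟩
      rw [Pi.single_eq_of_ne]
      rintro rfl
      exact hi hj
  choose e he using hsplit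
  let g : σ → MvPowerSeries σ K := fun i α =>
    e (α + single i 1) i * coeff (α + single i 1) f
  have hg : ∀ i α, coeff α (g i) = e (α + single i 1) i * coeff (α + single i 1) f :=
    fun _ _ => rfl
  refine ⟨g, fun i α hα => ?_, ?_⟩
  · rw [hg, hf _ _, mul_zero]
    rw [map_add, Finsupp.weight_single, one_smul]
    omega
  · ext β
    rw [map_sum]
    by_cases hβ : β = 0
    · subst hβ
      rw [hf 0 (by simpa using Nat.lt_of_succ_le hk)]
      simp
    · obtain ⟨h0, h1⟩ := he β hβ
      have : ∀ i, coeff β (X i * g i) = e β i * coeff β f := by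
        intro i
        rw [X, coeff_monomial_mul]
        split_ifs with h
        · rw [one_mul, hg, tsub_add_cancel_of_le h]
        · rw [h0 i, zero_mul]
          by_contra hi
          exact h (Finsupp.single_le_iff.2 (Nat.one_le_iff_ne_zero.2 hi))
      simp_rw [this]
      rw [← Finset.sum_mul, h1, one_mul]

/-- A derivation that is admissible on the variables preserves the weight filtration. -/
theorem derivation_mem_weightFiltration [Fintype σ] (hw : ∀ i, w i ≠ 0)
    (D : Derivation K (MvPowerSeries σ K) (MvPowerSeries σ K))
    (hD : ∀ i, D (X i) ∈ weightFiltration K w (w i)) (hf : f ∈ weightFiltration K w k) :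
    D f ∈ weightFiltration K w k := by
  induction k using Nat.strong_induction_on generalizing f with
  | _ k ih =>
    rcases Nat.eq_zero_or_pos k with rfl | hk
    · exact mem_weightFiltration_zero
    obtain ⟨g, hg, rfl⟩ := exists_eq_sum_X_mul hk hf
    rw [map_sum]
    refine Submodule.sum_mem _ fun i _ => ?_
    have hwi := hw i
    rw [D.leibniz, smul_eq_mul, smul_eq_mul]
    refine Submodule.add_mem _ ?_ ?_
    · exact weightFiltration_antitone (by omega)
        (mul_mem_weightFiltration (X_mem_weightFiltration i) (ih _ (by omega) (hg i)))
    · exact weightFiltration_antitone (by omega) (mul_mem_weightFiltration (hg i) (hD i))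

/-- Successive approximation: an operator preserving the weight filtration is surjective on a step
of it as soon as it is so on the associated graded pieces. -/
theorem exists_eq_of_forall_exists_sub_mem
    (T : MvPowerSeries σ K →ₗ[K] MvPowerSeries σ K)
    (hT : ∀ m f, f ∈ weightFiltration K w m → T f ∈ weightFiltration K w m)
    (h : ∀ m, k ≤ m → ∀ f ∈ weightFiltration K w m,
      ∃ g ∈ weightFiltration K w m, f - T g ∈ weightFiltration K w (m + 1))
    (hf : f ∈ weightFiltration K w k) : ∃ g ∈ weightFiltration K w k, T g = f := by
  choose! s hs₁ hs₂ using h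
  let r : ℕ → MvPowerSeries σ K := fun j => Nat.rec f (fun j r => r - T (s (k + j) r)) j
  have hr_succ : ∀ j, r (j + 1) = r j - T (s (k + j) (r j)) := fun _ => rfl
  have hr : ∀ j, r j ∈ weightFiltration K w (k + j) := by
    intro j
    induction j with
    | zero => exact hf
    | succ j ih => exact hs₂ (k + j) (by omega) _ ih
  let S : ℕ → MvPowerSeries σ K := fun N => ∑ j ∈ Finset.range N, s (k + j) (r j)
  have hS_succ : ∀ N, S (N + 1) = S N + s (k + N) (r N) := fun _ => Finset.sum_range_succ _ _
  have hS : ∀ N, f - T (S N) = r N := by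
    intro N
    induction N with
    | zero => simp [S, r]
    | succ N ih => rw [hr_succ, hS_succ, map_add, ← sub_sub, ih]
  have hS_stab : ∀ α N M, weight w α < k + N → N ≤ M → coeff α (S M) = coeff α (S N) := by
    intro α N M hα hNM
    induction M, hNM using Nat.le_induction with
    | base => rfl
    | succ M hM ih =>
      rw [hS_succ, map_add, ih,
        hs₁ (k + M) (by omega) _ (hr M) α (by omega), add_zero]
  let g : MvPowerSeries σ K := fun α => coeff α (S (weight w α + 1))
  have hg : ∀ N, g - S N ∈ weightFiltration K w (k + N) := by
    intro N α hα
    rw [map_sub, sub_eq_zero]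
    change coeff α (S (weight w α + 1)) = _
    rcases le_total N (weight w α + 1) with h | h
    · exact hS_stab _ _ _ hα h
    · exact (hS_stab _ _ _ (by omega) h).symm
  refine ⟨g, by simpa [S] using hg 0, sub_eq_zero.1 ?_⟩
  refine eq_zero_of_forall_mem_weightFiltration (w := w) fun N => ?_
  refine weightFiltration_antitone (Nat.le_add_left N k) ?_
  have : T g - f = T (g - S N) - r N := by rw [← hS, map_sub]; abel
  rw [this]
  exact Submodule.sub_mem _ (hT _ _ (hg N)) (hr N)

/-- A `K`-algebra endomorphism of the power series ring that is the identity on the associated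
graded algebra of the weight filtration, checked on the variables. -/
theorem algHom_sub_self_mem_weightFiltration [Fintype σ] (hw : ∀ i, w i ≠ 0)
    (ψ : MvPowerSeries σ K →ₐ[K] MvPowerSeries σ K)
    (hψ : ∀ i, ψ (X i) - X i ∈ weightFiltration K w (w i + 1))
    (hf : f ∈ weightFiltration K w k) : ψ f - f ∈ weightFiltration K w (k + 1) := by
  have hψX : ∀ i, ψ (X i) ∈ weightFiltration K w (w i) := fun i => by
    simpa using Submodule.add_mem _ (weightFiltration_antitone (Nat.le_succ _) (hψ i))
      (X_mem_weightFiltration i)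
  have hbase : ∀ f, ψ f - f ∈ weightFiltration K w 1 := by
    intro f
    have hg := sub_C_constantCoeff_mem_weightFiltration (f := f) hw
    obtain ⟨g, -, hfg⟩ := exists_eq_sum_X_mul le_rfl hg
    have hC : ψ (C (constantCoeff f)) = C (constantCoeff f) := ψ.commutes (constantCoeff f)
    have : ψ f - f = ∑ i, ψ (X i) * ψ (g i) - (f - C (constantCoeff f)) := by
      simp_rw [← map_mul, ← map_sum, ← hfg, map_sub, hC]
      abel
    rw [this]
    refine Submodule.sub_mem _ (Submodule.sum_mem _ fun i _ => ?_) hg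
    exact weightFiltration_antitone (by have := hw i; omega)
      (mul_mem_weightFiltration (hψX i) (mem_weightFiltration_zero (f := ψ (g i))))
  induction k using Nat.strong_induction_on generalizing f with
  | _ k ih =>
    rcases Nat.eq_zero_or_pos k with rfl | hk
    · exact hbase f
    obtain ⟨g, hg, rfl⟩ := exists_eq_sum_X_mul hk hf
    rw [map_sum, ← Finset.sum_sub_distrib]
    refine Submodule.sum_mem _ fun i _ => ?_
    have hwi := hw i
    have hsub := ih _ (by omega) (hg i)
    have hψg : ψ (g i) ∈ weightFiltration K w (k - w i) := by
      simpa using Submodule.add_mem _ (weightFiltration_antitone (Nat.le_succ _) hsub) (hg i)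
    have : ψ (X i * g i) - X i * g i = (ψ (X i) - X i) * ψ (g i) + X i * (ψ (g i) - g i) := by
      rw [map_mul]; ring
    rw [this]
    refine Submodule.add_mem _ ?_ ?_
    · exact weightFiltration_antitone (by omega) (mul_mem_weightFiltration (hψ i) hψg)
    · exact weightFiltration_antitone (by omega)
        (mul_mem_weightFiltration (X_mem_weightFiltration i) hsub)

theorem bijective_of_sub_self_mem_weightFiltration
    (T : MvPowerSeries σ K →ₗ[K] MvPowerSeries σ K)
    (hT : ∀ m f, f ∈ weightFiltration K w m → T f - f ∈ weightFiltration K w (m + 1)) :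
    Function.Bijective T := by
  constructor
  · rw [injective_iff_map_eq_zero]
    intro f hf
    refine eq_zero_of_forall_mem_weightFiltration (w := w) fun k => ?_
    induction k with
    | zero => exact mem_weightFiltration_zero
    | succ k ih => simpa [hf] using hT k f ih
  · intro f
    obtain ⟨g, -, hg⟩ := exists_eq_of_forall_exists_sub_mem (w := w) (k := 0) (f := f) T
      (fun m f hf => by
        simpa using Submodule.add_mem _ (weightFiltration_antitone (Nat.le_succ _) (hT m f hf)) hf)
      (fun m _ f hf => ⟨f, hf, by simpa using Submodule.neg_mem _ (hT m f hf)⟩)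
      mem_weightFiltration_zero
    exact ⟨g, hg⟩

/-- Substituting for the variables power series with the same leading weighted terms defines an
automorphism of the power series ring. -/
theorem exists_algEquiv_of_sub_X_mem_weightFiltration [Fintype σ] (hw : ∀ i, w i ≠ 0)
    (y : σ → MvPowerSeries σ K) (hy : ∀ i, y i - X i ∈ weightFiltration K w (w i + 1)) :
    ∃ ψ : MvPowerSeries σ K ≃ₐ[K] MvPowerSeries σ K, ∀ i, ψ (X i) = y i := by
  have hsubst : HasSubst y := hasSubst_of_constantCoeff_zero fun i => by
    simpa using hy i 0 (by simp)
  refine ⟨AlgEquiv.ofBijective (substAlgHom hsubst)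
    (bijective_of_sub_self_mem_weightFiltration (w := w) (substAlgHom hsubst).toLinearMap
      fun m f hf => algHom_sub_self_mem_weightFiltration hw (substAlgHom hsubst) (fun i => ?_) hf),
    fun i => ?_⟩
  · rw [substAlgHom_X]
    exact hy i
  · exact substAlgHom_X hsubst i

end WeightFiltration
section LeadingTerms

variable {K σ : Type*} [Field K] [Fintype σ] {w : σ → ℕ} {k m : ℕ} {f g : MvPowerSeries σ K}

/-- The possible eigenvalues, in weight `k`, of a derivation acting on the variable `x^i` with
eigenvalue `l i`. -/
def weightSpectrum (w : σ → ℕ) (l : σ → K) (k : ℕ) : Set K :=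
  {μ | ∃ α : σ →₀ ℕ, weight w α = k ∧ ∑ i, (α i : K) * l i = μ}

theorem add_mem_weightSpectrum {l : σ → K} {μ ν : K} (hμ : μ ∈ weightSpectrum w l k)
    (hν : ν ∈ weightSpectrum w l m) : μ + ν ∈ weightSpectrum w l (k + m) := by
  obtain ⟨α, hα, rfl⟩ := hμ
  obtain ⟨β, hβ, rfl⟩ := hν
  exact ⟨α + β, by rw [map_add, hα, hβ], by simp [add_mul, Finset.sum_add_distrib]⟩

theorem mem_weightSpectrum (l : σ → K) (i : σ) : l i ∈ weightSpectrum w l (w i) := by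
  classical
  refine ⟨single i 1, by simp [Finsupp.weight_single], ?_⟩
  rw [Finset.sum_eq_single i] <;> simp +contextual [eq_comm]

/-- Modulo higher weight, `f` of weight `k` is a sum of generalized eigenvectors of `D` with
eigenvalues in `weightSpectrum w l k`. -/
abbrev IsWeightGenEigen (D : Derivation K (MvPowerSeries σ K) (MvPowerSeries σ K)) (w : σ → ℕ)
    (l : σ → K) (k : ℕ) (f : MvPowerSeries σ K) : Prop :=
  Module.End.IsGenEigen (D : MvPowerSeries σ K →ₗ[K] MvPowerSeries σ K) (weightSpectrum w l k)
    (weightFiltration K w (k + 1)) f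

variable {D : Derivation K (MvPowerSeries σ K) (MvPowerSeries σ K)} {l : σ → K}

theorem IsWeightGenEigen.mul
    (hD : ∀ k f, f ∈ weightFiltration K w k → D f ∈ weightFiltration K w k)
    (hfk : f ∈ weightFiltration K w k) (hgm : g ∈ weightFiltration K w m)
    (hf : IsWeightGenEigen D w l k f) (hg : IsWeightGenEigen D w l m g) :
    IsWeightGenEigen D w l (k + m) (f * g) := by
  induction hf generalizing g with
  | of_mem hf =>
    refine .of_mem (weightFiltration_antitone (by omega) (mul_mem_weightFiltration hf hgm))
  | @of_sub f μ hμ hf ihf =>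
    induction hg with
    | of_mem hg =>
      exact .of_mem (weightFiltration_antitone (by omega) (mul_mem_weightFiltration hfk hg))
    | @of_sub g ν hν hg ihg =>
      refine .of_sub (μ + ν) (add_mem_weightSpectrum hμ hν) ?_
      have : D (f * g) - (μ + ν) • (f * g) = (D f - μ • f) * g + f * (D g - ν • g) := by
        rw [D.leibniz, smul_eq_mul, smul_eq_mul]
        simp only [smul_eq_C_mul, map_add]
        ring
      change IsWeightGenEigen D w l (k + m) (D (f * g) - (μ + ν) • (f * g))
      rw [this]
      refine .add (hD _) ?_ ?_
      · exact ihf (Submodule.sub_mem _ (hD _ _ hfk) (Submodule.smul_mem _ _ hfk)) hgm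
          (.of_sub ν hν hg)
      · exact ihg (Submodule.sub_mem _ (hD _ _ hgm) (Submodule.smul_mem _ _ hgm))

theorem isWeightGenEigen_monomial
    (hD : ∀ k f, f ∈ weightFiltration K w k → D f ∈ weightFiltration K w k) {α : σ →₀ ℕ}
    (hα : ∀ i, α i ≠ 0 → IsWeightGenEigen D w l (w i) (X i)) :
    IsWeightGenEigen D w l (weight w α) (monomial α 1) := by
  classical
  have hone : IsWeightGenEigen D w l 0 1 := by
    refine .of_sub 0 ⟨0, by simp⟩ ?_
    simpa using Module.End.IsGenEigen.zero
  have hmul : ∀ α β : σ →₀ ℕ, IsWeightGenEigen D w l (weight w α) (monomial α 1) →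
      IsWeightGenEigen D w l (weight w β) (monomial β 1) →
      IsWeightGenEigen D w l (weight w (α + β)) (monomial (α + β) 1) := by
    intro α β h₁ h₂
    have := h₁.mul hD (monomial_mem_weightFiltration α 1) (monomial_mem_weightFiltration β 1) h₂
    rwa [monomial_mul_monomial, one_mul, ← map_add] at this
  induction α using Finsupp.induction_linear with
  | zero => simpa using hone
  | add α β ihα ihβ =>
    exact hmul α β (ihα fun i hi => hα i (by simp [hi])) (ihβ fun i hi => hα i (by simp [hi]))
  | single i e =>
    induction e with
    | zero => simpa using hone
    | succ e ih =>
      have hi : IsWeightGenEigen D w l (w i) (X i) := hα i (by simp)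
      rw [Finsupp.single_add]
      refine hmul _ _ (ih fun j hj => ?_) (by simpa [Finsupp.weight_single, X] using hi)
      obtain rfl : j = i := by
        by_contra h
        simp [Ne.symm h] at hj
      exact hi

theorem isWeightGenEigen_coe
    (hD : ∀ k f, f ∈ weightFiltration K w k → D f ∈ weightFiltration K w k)
    {p : MvPolynomial σ K} (hp : ∀ α ∈ p.support, weight w α = k)
    (hvars : ∀ α ∈ p.support, ∀ i, α i ≠ 0 → IsWeightGenEigen D w l (w i) (X i)) :
    IsWeightGenEigen D w l k p := by
  rw [coe_eq_sum_smul_monomial]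
  refine .sum (hD _) _ _ fun α hα => .smul _ ?_
  rw [← hp α hα]
  exact isWeightGenEigen_monomial hD (hvars α hα)

theorem isWeightGenEigen_of_forall_X (hw : ∀ i, w i ≠ 0)
    (hD : ∀ k f, f ∈ weightFiltration K w k → D f ∈ weightFiltration K w k)
    (hX : ∀ i, IsWeightGenEigen D w l (w i) (X i)) (hf : f ∈ weightFiltration K w k) :
    IsWeightGenEigen D w l k f := by
  classical
  let s := (Finsupp.finite_of_nat_weight_eq w hw k).toFinset
  have hs : ∀ α, α ∈ s ↔ weight w α = k := fun α => by simp [s]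
  have hsum : IsWeightGenEigen D w l k (∑ α ∈ s, coeff α f • monomial α (1 : K)) := by
    refine .sum (hD _) _ _ fun α hα => .smul _ ?_
    rw [← (hs α).1 hα]
    exact isWeightGenEigen_monomial hD fun i _ => hX i
  have hsub : f - ∑ α ∈ s, coeff α f • monomial α (1 : K) ∈ weightFiltration K w (k + 1) := by
    intro α hα
    have : coeff α (∑ α ∈ s, coeff α f • monomial α (1 : K)) = if α ∈ s then coeff α f else 0 := by
      simp [coeff_monomial]
    rw [map_sub, this]
    split_ifs with h
    · exact sub_self _
    · rw [sub_zero]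
      exact hf α (lt_of_le_of_ne (Nat.lt_succ_iff.1 hα) fun h' => h ((hs α).2 h'))
  simpa using hsum.add (hD _) (.of_mem hsub)

/-- A non-resonant shift of an admissible derivation is surjective on the corresponding step of the
weight filtration. -/
theorem exists_derivation_sub_smul_eq
    (hD : ∀ k f, f ∈ weightFiltration K w k → D f ∈ weightFiltration K w k)
    (hgen : ∀ k f, f ∈ weightFiltration K w k → IsWeightGenEigen D w l k f) {μ : K}
    (hμ : ∀ m, k ≤ m → μ ∉ weightSpectrum w l m) (hf : f ∈ weightFiltration K w k) :
    ∃ g ∈ weightFiltration K w k, D g - μ • g = f :=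
  exists_eq_of_forall_exists_sub_mem
    ((D : MvPowerSeries σ K →ₗ[K] MvPowerSeries σ K) - μ • LinearMap.id)
    (fun m g hg => Submodule.sub_mem _ (hD m g hg) (Submodule.smul_mem _ _ hg))
    (fun m hm g hg => (hgen m g hg).exists_sub_mem (hμ m hm) (hD m) hg) hf

theorem exists_aeval_prod_eq
    (hD : ∀ k f, f ∈ weightFiltration K w k → D f ∈ weightFiltration K w k)
    (hgen : ∀ k f, f ∈ weightFiltration K w k → IsWeightGenEigen D w l k f)
    {ι : Type*} (s : Finset ι) (μ : ι → K)
    (hμ : ∀ i ∈ s, ∀ m, k ≤ m → μ i ∉ weightSpectrum w l m) (hf : f ∈ weightFiltration K w k) :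
    ∃ g ∈ weightFiltration K w k,
      Polynomial.aeval (D : MvPowerSeries σ K →ₗ[K] MvPowerSeries σ K)
        (∏ i ∈ s, (Polynomial.X - Polynomial.C (μ i))) g = f := by
  classical
  induction s using Finset.induction_on generalizing f with
  | empty => exact ⟨f, hf, by simp⟩
  | insert i s hi ih =>
    obtain ⟨h, hh, rfl⟩ := exists_derivation_sub_smul_eq hD hgen
      (hμ i (Finset.mem_insert_self i s)) hf
    obtain ⟨g, hg, rfl⟩ := ih (fun j hj => hμ j (Finset.mem_insert_of_mem hj)) hh
    refine ⟨g, hg, ?_⟩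
    rw [Finset.prod_insert hi, map_mul, Module.End.mul_apply, map_sub, Polynomial.aeval_X,
      Polynomial.aeval_C, LinearMap.sub_apply, Module.algebraMap_end_apply]
    rfl

end LeadingTerms

section Linearization

/-- The part of the weight-`c` polynomial `p` that is not linear in the variables of weight `c`. -/
noncomputable def decomposablePart {K σ : Type*} [Field K] [Fintype σ] (w : σ → ℕ) (c : ℕ)
    (p : MvPolynomial σ K) : MvPolynomial σ K :=
  p - ∑ j : {j // w j = c}, p.coeff (single j.1 1) • MvPolynomial.X j.1

variable {K σ : Type*} [Field K] [Fintype σ] {w : σ → ℕ} {c : ℕ}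

theorem weight_eq_and_lt_of_mem_support_decomposablePart (hw : ∀ i, w i ≠ 0)
    {p : MvPolynomial σ K} (hp : ∀ α ∈ p.support, weight w α = c) {α : σ →₀ ℕ}
    (hα : α ∈ (decomposablePart w c p).support) :
    weight w α = c ∧ ∀ i, α i ≠ 0 → w i < c := by
  classical
  have : Finsupp.NonTorsionWeight ℕ w := Finsupp.nonTorsionWeight_of ℕ w hw
  have hcoeff : ∀ β, (decomposablePart w c p).coeff β = p.coeff β -
      ∑ j : {j // w j = c}, if single j.1 1 = β then p.coeff (single j.1 1) else 0 := by
    intro β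
    simp [decomposablePart, MvPolynomial.coeff_sum, MvPolynomial.coeff_X]
  rw [MvPolynomial.mem_support_iff, hcoeff] at hα
  have hne : ∀ i, w i = c → single i 1 ≠ α := by
    rintro i hi rfl
    refine hα ?_
    rw [Finset.sum_eq_single ⟨i, hi⟩]
    · simp
    · rintro ⟨j, hj⟩ - hji
      refine if_neg fun h => hji ?_
      exact Subtype.ext (Finsupp.single_left_injective one_ne_zero h)
    · simp
  rw [Finset.sum_eq_zero fun j _ => if_neg (hne j.1 j.2), sub_zero,
    ← MvPolynomial.mem_support_iff] at hα
  have hαc := hp α hα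
  refine ⟨hαc, fun i hi => ?_⟩
  have hadd := Finsupp.weight_sub_single_add (w := w) hi
  refine lt_of_le_of_ne (by omega) fun hic => hne i hic ?_
  have h0 := (Finsupp.weight_eq_zero_iff_eq_zero w (f := α - single i 1)).1 (by omega)
  rw [← Finsupp.sub_add_single_one_cancel hi, h0, zero_add]

theorem map_decomposablePart {S : Type*} [CommRing S] [Algebra K S] (φ : MvPolynomial σ K →ₐ[K] S)
    (p : MvPolynomial σ K) :
    φ (decomposablePart w c p) =
      φ p - ∑ j : {j // w j = c}, p.coeff (single j.1 1) • φ (MvPolynomial.X j.1) := by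
  simp [decomposablePart]

theorem coe_decomposablePart (p : MvPolynomial σ K) :
    (decomposablePart w c p : MvPowerSeries σ K) =
      (p : MvPowerSeries σ K) - ∑ j : {j // w j = c}, p.coeff (single j.1 1) • X j.1 := by
  simpa using map_decomposablePart (w := w) (c := c)
    (MvPolynomial.coeToMvPowerSeries.algHom K) p

/-- The linear part of the tuple of polynomials `P` in the variables of weight `c`. -/
noncomputable def linearBlock (w : σ → ℕ) (P : σ → MvPolynomial σ K) (c : ℕ) :
    Matrix {i // w i = c} {i // w i = c} K :=
  Matrix.of fun i j => (P i.1).coeff (single j.1 1)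

variable [DecidableEq σ] {D : Derivation K (MvPowerSeries σ K) (MvPowerSeries σ K)} {l : σ → K}
  {P : σ → MvPolynomial σ K}

theorem isWeightGenEigen_X (hw : ∀ i, w i ≠ 0)
    (hD : ∀ k f, f ∈ weightFiltration K w k → D f ∈ weightFiltration K w k)
    (hP : ∀ i, ∀ α ∈ (P i).support, weight w α = w i)
    (hDP : ∀ i, D (X i) - P i ∈ weightFiltration K w (w i + 1))
    (hl : ∀ i, (linearBlock w P (w i)).charpoly =
      ∏ j : {j // w j = w i}, (Polynomial.X - Polynomial.C (l j.1))) (i : σ) :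
    IsWeightGenEigen D w l (w i) (X i) := by
  obtain ⟨c, hc⟩ : ∃ c, w i = c := ⟨_, rfl⟩
  induction c using Nat.strong_induction_on generalizing i with
  | _ c ih =>
    subst hc
    refine .of_aeval_prod Finset.univ (fun j : {j // w j = w i} => l j.1) (fun j _ => ?_) ?_
    · have := mem_weightSpectrum (w := w) l j.1
      rwa [j.2] at this
    rw [← hl i, Module.End.aeval_charpoly_apply _ (linearBlock w P (w i)) (fun j => X j.1) ⟨i, rfl⟩]
    refine .sum (hD _) _ _ fun j _ => .aeval (hD _) ?_ _
    have hj := hDP j.1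
    have hPj := hP j.1
    rw [j.2] at hj hPj
    have hsupp := fun α =>
      weight_eq_and_lt_of_mem_support_decomposablePart (α := α) hw hPj
    have heq : D (X j.1) - ∑ k : {k // w k = w i}, linearBlock w P (w i) j k • X k.1 =
        (D (X j.1) - (P j.1 : MvPowerSeries σ K)) +
          (decomposablePart w (w i) (P j.1) : MvPowerSeries σ K) := by
      rw [coe_decomposablePart, sub_add_sub_cancel]
      rfl
    change IsWeightGenEigen D w l (w i)
      (D (X j.1) - ∑ k : {k // w k = w i}, linearBlock w P (w i) j k • X k.1)
    rw [heq]
    refine .add (hD _) (.of_mem hj) (isWeightGenEigen_coe hD (fun α hα => (hsupp α hα).1) ?_)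
    exact fun α hα k hk => ih _ ((hsupp α hα).2 k hk) k rfl

/-- New coordinates, tangent to the given ones to higher weight, in which a non-resonant admissible
derivation takes its weighted normal form in all weights below `c`. -/
theorem exists_normal_coordinates (hw : ∀ i, w i ≠ 0)
    (hD : ∀ k f, f ∈ weightFiltration K w k → D f ∈ weightFiltration K w k)
    (hP : ∀ i, ∀ α ∈ (P i).support, weight w α = w i)
    (hDP : ∀ i, D (X i) - P i ∈ weightFiltration K w (w i + 1))
    (hl : ∀ i, (linearBlock w P (w i)).charpoly =
      ∏ j : {j // w j = w i}, (Polynomial.X - Polynomial.C (l j.1)))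
    (hres : ∀ i m, w i < m → l i ∉ weightSpectrum w l m) (c : ℕ) :
    ∃ y : σ → MvPowerSeries σ K, (∀ i, y i - X i ∈ weightFiltration K w (w i + 1)) ∧
      ∀ i, w i < c → D (y i) = MvPolynomial.aeval y (P i) := by
  have hgen : ∀ k f, f ∈ weightFiltration K w k → IsWeightGenEigen D w l k f := fun k f =>
    isWeightGenEigen_of_forall_X hw hD (isWeightGenEigen_X hw hD hP hDP hl)
  induction c with
  | zero => exact ⟨X, fun i => by simp, fun i hi => by omega⟩
  | succ c ih =>
    obtain ⟨y, hy, hDy⟩ := ih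
    have hdec : ∀ i, w i = c → ∀ α ∈ (decomposablePart w c (P i)).support,
        weight w α = c ∧ ∀ j, α j ≠ 0 → w j < c := fun i hi α hα =>
      weight_eq_and_lt_of_mem_support_decomposablePart hw (fun α hα => (hP i α hα).trans hi) hα
    obtain ⟨ψ, hψ⟩ := exists_algEquiv_of_sub_X_mem_weightFiltration hw y hy
    let B := linearBlock w P c
    have hr : ∀ i : {i // w i = c},
        MvPolynomial.aeval y (decomposablePart w c (P i.1)) + ∑ j, B i j • X j.1 - D (X i.1) ∈
          weightFiltration K w (c + 1) := by
      rintro ⟨i, hi⟩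
      have h₁ := algHom_sub_self_mem_weightFiltration hw (ψ : _ →ₐ[K] _)
        (fun i => by simpa [hψ i] using hy i)
        (coe_mem_weightFiltration (p := decomposablePart w c (P i)) fun α hα => (hdec i hi α hα).1.ge)
      have h₂ := hDP i
      rw [hi] at h₂
      rw [algHom_coe_eq_aeval] at h₁
      convert Submodule.sub_mem _ h₁ h₂ using 1
      rw [coe_decomposablePart]
      simp only [AlgEquiv.coe_toAlgHom, hψ, B, linearBlock, Matrix.of_apply]
      abel
    obtain ⟨g, hg, hDg⟩ := Module.End.exists_map_sub_sum_smul_eq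
      (D : MvPowerSeries σ K →ₗ[K] MvPowerSeries σ K) B (hD (c + 1)) _ fun i => by
        have hi := hl i.1
        rw [i.2] at hi
        rw [hi]
        exact exists_aeval_prod_eq hD hgen _ _
          (fun j _ m hm => hres j.1 m (by have := j.2; omega)) (hr i)
    let z : σ → MvPowerSeries σ K := fun i => if h : w i = c then X i + g ⟨i, h⟩ else y i
    have hz_eq : ∀ i : {i // w i = c}, z i.1 = X i.1 + g i := fun i => dif_pos i.2
    have hz_lt : ∀ i, w i < c → z i = y i := fun i hi => dif_neg hi.ne
    refine ⟨z, fun i => ?_, fun i hi => ?_⟩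
    · by_cases h : w i = c
      · rw [hz_eq ⟨i, h⟩, add_sub_cancel_left, h]
        exact hg _
      · simpa [z, h] using hy i
    · rcases (Nat.lt_succ_iff.1 hi).lt_or_eq with hlt | heq
      · rw [hz_lt i hlt, hDy i hlt]
        refine aeval_congr_of_mem_support fun α hα j hj => (hz_lt j ?_).symm
        have := Finsupp.le_weight_of_ne_zero' (w := w) hj
        have := hP i α hα
        omega
      · have hmap := map_decomposablePart (w := w) (c := c) (MvPolynomial.aeval z) (P i)
        have hlow : MvPolynomial.aeval z (decomposablePart w c (P i)) =
            MvPolynomial.aeval y (decomposablePart w c (P i)) :=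
          aeval_congr_of_mem_support fun α hα j hj => hz_lt j ((hdec i heq α hα).2 j hj)
        have hgi := hDg ⟨i, heq⟩
        rw [hlow, eq_sub_iff_add_eq] at hmap
        simp only [MvPolynomial.aeval_X, hz_eq, smul_add, Finset.sum_add_distrib] at hmap
        rw [← hmap, hz_eq ⟨i, heq⟩, map_add]
        simp only [Derivation.coeFn_coe, B, linearBlock, Matrix.of_apply] at hgi
        rw [sub_eq_iff_eq_add.1 hgi]
        abel

/-- **Formal weighted linearization**, for a derivation preserving the weight filtration. -/
theorem exists_algEquiv_conj_eq (hw : ∀ i, w i ≠ 0)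
    (hD : ∀ k f, f ∈ weightFiltration K w k → D f ∈ weightFiltration K w k)
    (hP : ∀ i, ∀ α ∈ (P i).support, weight w α = w i)
    (hDP : ∀ i, D (X i) - P i ∈ weightFiltration K w (w i + 1))
    (hl : ∀ i, (linearBlock w P (w i)).charpoly =
      ∏ j : {j // w j = w i}, (Polynomial.X - Polynomial.C (l j.1)))
    (hres : ∀ i m, w i < m → l i ∉ weightSpectrum w l m) :
    ∃ φ : MvPowerSeries σ K ≃ₐ[K] MvPowerSeries σ K, ∀ i, φ (D (φ.symm (X i))) = P i := by
  obtain ⟨y, hy, hDy⟩ := exists_normal_coordinates hw hD hP hDP hl hres (Finset.univ.sup w + 1)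
  obtain ⟨ψ, hψ⟩ := exists_algEquiv_of_sub_X_mem_weightFiltration hw y hy
  refine ⟨ψ.symm, fun i => ?_⟩
  have hcoe := algHom_coe_eq_aeval (ψ : _ →ₐ[K] _) (P i)
  simp only [AlgEquiv.coe_toAlgHom, hψ] at hcoe
  rw [AlgEquiv.symm_symm, hψ, hDy i (Nat.lt_succ_of_le (Finset.le_sup (Finset.mem_univ i))),
    ← hcoe, AlgEquiv.symm_apply_apply]

end Linearization

end MvPowerSeries

/-- **Formal weighted linearization of non-resonant vector fields.**
Let `K` be a field of characteristic zero, `w` a weighting of `K^n`, and `D` a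
`w`-admissible `K`-linear derivation of `R = MvPowerSeries (Fin n) K` with weighted
linear approximation components `P^i ∈ MvPolynomial (Fin n) K`.  Let `A i j` be the
coefficient of `x^j` in `P^i`, and suppose `λ : Fin n → K` is a `w`-compatible ordering
of the eigenvalues of `A` (blockwise characteristic polynomial condition) that is
non-resonant with respect to `w`.  Then there is a `K`-algebra automorphism `φ` of `R`
such that `φ (D (φ⁻¹ x^i)) = P^i` for every `i`, i.e. the pullback `φ*D` agrees with the
weighted linear approximation on the generators. -/
theorem formal_weighted_linearization_of_nonresonant
    (K : Type*) [Field K] [CharZero K] (n : ℕ)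
    (w : Fin n → ℕ) (hw1 : ∀ i, 1 ≤ w i) (hwmono : Monotone w)
    (D : Derivation K (MvPowerSeries (Fin n) K) (MvPowerSeries (Fin n) K))
    (hadm : ∀ (i : Fin n) (α : Fin n →₀ ℕ), (∑ j, w j * α j) < w i →
      MvPowerSeries.coeff α (D (MvPowerSeries.X i)) = 0)
    (P : Fin n → MvPolynomial (Fin n) K)
    (hP : ∀ (i : Fin n) (α : Fin n →₀ ℕ),
      MvPolynomial.coeff α (P i) =
        if (∑ j, w j * α j) = w i then MvPowerSeries.coeff α (D (MvPowerSeries.X i))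
        else 0)
    (A : Matrix (Fin n) (Fin n) K)
    (hA : ∀ i j, A i j = MvPolynomial.coeff (Finsupp.single j 1) (P i))
    (l : Fin n → K)
    (hl : ∀ c : ℕ, c ∈ Set.range w →
      (A.submatrix
          (Subtype.val : {i : Fin n // w i = c} → Fin n)
          (Subtype.val : {i : Fin n // w i = c} → Fin n)).charpoly =
        ∏ i : {i : Fin n // w i = c}, (Polynomial.X - Polynomial.C (l i.val)))
    (hres : ∀ (i : Fin n) (α : Fin n →₀ ℕ), w i < ∑ j, w j * α j →
      (∑ j, (α j : K) * l j) ≠ l i) :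
    ∃ φ : MvPowerSeries (Fin n) K ≃ₐ[K] MvPowerSeries (Fin n) K,
      ∀ i : Fin n, φ (D (φ.symm (MvPowerSeries.X i))) = (P i : MvPowerSeries (Fin n) K) := by
  have hw : ∀ i, w i ≠ 0 := fun i => Nat.one_le_iff_ne_zero.1 (hw1 i)
  have hwt : ∀ α : Fin n →₀ ℕ, Finsupp.weight w α = ∑ j, w j * α j := fun α => by
    simp [Finsupp.weight_eq_sum, mul_comm]
  refine MvPowerSeries.exists_algEquiv_conj_eq (w := w) (l := l) hw (fun k f hf => ?_)
    (fun i α hα => ?_) (fun i α hα => ?_) (fun i => ?_) ?_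
  · refine MvPowerSeries.derivation_mem_weightFiltration hw D (fun i α hα => ?_) hf
    exact hadm i α (hwt α ▸ hα)
  · by_contra h
    rw [MvPolynomial.mem_support_iff, hP, ← hwt, if_neg h] at hα
    exact hα rfl
  · rw [map_sub, MvPolynomial.coeff_coe, hP, ← hwt]
    split_ifs with h
    · exact sub_self _
    · rw [sub_zero]
      exact hadm i α (by rw [← hwt]; omega)
  · rw [← hl (w i) ⟨i, rfl⟩]
    congr 1
    ext j k
    exact (hA j.1 k.1).symm
  · rintro i m hm ⟨α, rfl, h⟩
    exact hres i α (hwt α ▸ hm) h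
end

section
/- Let K be a field of characteristic zero, w a weighting of K^n, and X a K-linear derivation of R = MvPowerSeries (Fin n) K that is w-admissible, with weighted linear approximation components P^i ∈ MvPolynomial (Fin n) K. Suppose that for every integer k ≥ 1, the adjoint operator ad_P is bijective on quasi-homogeneous polynomial vector fields of weighted degree k: for every tuple Y : Fin n → MvPolynomial (Fin n) K in which every multi-index β in the support of Y^i satisfies ⟨w,β⟩ = w i + k, there exists a unique tuple U with the same quasi-homogeneity property such that for every i, Σ_j (P^j · pderiv j (U^i) − U^j · pderiv j (P^i)) = Y^i. Then there exists a K-algebra automorphism φ of R such that for every i, φ(X(φ⁻¹(x^i))) = P^i (viewed in R); i.e. the pullback φ*X = φ∘X∘φ⁻¹ agrees with the weighted linear approximation of X on the generators. -/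
namespace WeightedLinearization

theorem aeval_sub_aeval_mem {σ K A : Type*} [Field K] [CommRing A] [Algebra K A]
    (I : Ideal A) {F G : σ → A}
    (h : ∀ i, F i - G i ∈ I) (p : MvPolynomial σ K) :
    MvPolynomial.aeval F p - MvPolynomial.aeval G p ∈ I := by
  induction p using MvPolynomial.induction_on with
  | C a => simp
  | add p q hp hq =>
    rw [map_add, map_add, add_sub_add_comm]
    exact add_mem hp hq
  | mul_X p i hp =>
    rw [map_mul, map_mul, MvPolynomial.aeval_X, MvPolynomial.aeval_X]
    convert add_mem (I.mul_mem_right (F i) hp) (I.mul_mem_left (MvPolynomial.aeval G p) (h i))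
      using 1
    ring

variable {σ K : Type*} [Fintype σ] [Field K]

/-- The ideal of power series all of whose monomials have weight at least `d`. -/
def weightIdeal (K : Type*) [Field K] (w : σ → ℕ) (d : ℕ) : Ideal (MvPowerSeries σ K) where
  carrier := {f | ∀ α : σ →₀ ℕ, ∑ j, w j * α j < d → MvPowerSeries.coeff α f = 0}
  add_mem' hf hg α hα := by rw [map_add, hf α hα, hg α hα, add_zero]
  zero_mem' _ _ := map_zero _
  smul_mem' c f hf α hα := by
    classical
    rw [smul_eq_mul, MvPowerSeries.coeff_mul]
    refine Finset.sum_eq_zero fun p hp => ?_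
    rw [hf p.2, mul_zero]
    refine lt_of_le_of_lt (Finset.sum_le_sum fun j _ => ?_) hα
    rw [← Finset.HasAntidiagonal.mem_antidiagonal.mp hp]
    exact Nat.mul_le_mul_left _ (by simp)

variable {w : σ → ℕ} {d e : ℕ} {f g : MvPowerSeries σ K}

theorem mem_weightIdeal : f ∈ weightIdeal K w d ↔
    ∀ α : σ →₀ ℕ, ∑ j, w j * α j < d → MvPowerSeries.coeff α f = 0 := Iff.rfl

theorem weightIdeal_zero (f : MvPowerSeries σ K) : f ∈ weightIdeal K w 0 :=
  fun _ h => absurd h (Nat.not_lt_zero _)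

theorem weightIdeal_antitone (h : d ≤ e) : weightIdeal K w e ≤ weightIdeal K w d :=
  fun _ hf α hα => hf α (hα.trans_le h)

theorem mul_mem_weightIdeal (hf : f ∈ weightIdeal K w d) (hg : g ∈ weightIdeal K w e) :
    f * g ∈ weightIdeal K w (d + e) := by
  classical
  intro α hα
  rw [MvPowerSeries.coeff_mul]
  refine Finset.sum_eq_zero fun p hp => ?_
  have hsum : ∑ j, w j * α j = ∑ j, w j * p.1 j + ∑ j, w j * p.2 j := by
    rw [← Finset.sum_add_distrib, ← Finset.HasAntidiagonal.mem_antidiagonal.mp hp]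
    simp [mul_add]
  by_cases h : ∑ j, w j * p.1 j < d
  · rw [hf _ h, zero_mul]
  · rw [hg _ (by omega), mul_zero]

theorem eq_zero_of_forall_mem_weightIdeal (h : ∀ d, f ∈ weightIdeal K w d) : f = 0 := by
  ext α
  exact h (∑ j, w j * α j + 1) α (Nat.lt_succ_self _)

theorem sum_weight_add_single [DecidableEq σ] (α : σ →₀ ℕ) (i : σ) (k : ℕ) :
    ∑ j, w j * (α + Finsupp.single i k) j = ∑ j, w j * α j + w i * k := by
  simp [mul_add, Finset.sum_add_distrib, Finsupp.single_apply]

theorem X_mem_weightIdeal (i : σ) : (MvPowerSeries.X i : MvPowerSeries σ K) ∈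
    weightIdeal K w (w i) := by
  classical
  intro α hα
  rw [MvPowerSeries.coeff_X, if_neg]
  rintro rfl
  simp [Finsupp.single_apply] at hα

theorem coe_mem_weightIdeal {p : MvPolynomial σ K}
    (hp : ∀ β ∈ p.support, d ≤ ∑ j, w j * β j) :
    (p : MvPowerSeries σ K) ∈ weightIdeal K w d := by
  intro α hα
  rw [MvPolynomial.coeff_coe]
  by_contra h
  exact absurd (hp α (MvPolynomial.mem_support_iff.mpr h)) (by omega)

theorem coe_pderiv_mem_weightIdeal {p : MvPolynomial σ K}
    (hp : ∀ β ∈ p.support, d ≤ ∑ j, w j * β j) (i : σ) :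
    (MvPolynomial.pderiv i p : MvPowerSeries σ K) ∈ weightIdeal K w (d - w i) := by
  classical
  refine coe_mem_weightIdeal fun β hβ => ?_
  rw [MvPolynomial.mem_support_iff, MvPolynomial.coeff_pderiv] at hβ
  have h := hp _ (MvPolynomial.mem_support_iff.mpr (left_ne_zero_of_mul hβ))
  rw [sum_weight_add_single] at h
  omega

/-- The weight filtration is complete. -/
theorem exists_limit (F : ℕ → MvPowerSeries σ K)
    (hF : ∀ k, F (k + 1) - F k ∈ weightIdeal K w k) :
    ∃ f, ∀ k, f - F k ∈ weightIdeal K w k := by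
  have hmono : ∀ k m, F (k + m) - F k ∈ weightIdeal K w k := by
    intro k m
    induction m with
    | zero => simp
    | succ m ih =>
      have := add_mem (weightIdeal_antitone (Nat.le_add_right k m) (hF (k + m))) ih
      rwa [sub_add_sub_cancel] at this
  let f : MvPowerSeries σ K := fun α => MvPowerSeries.coeff α (F (∑ j, w j * α j + 1))
  have hf : ∀ α, MvPowerSeries.coeff α f = MvPowerSeries.coeff α (F (∑ j, w j * α j + 1)) :=
    fun _ => rfl
  refine ⟨f, fun k α hα => ?_⟩
  obtain ⟨m, rfl⟩ := Nat.exists_eq_add_of_le (Nat.succ_le_of_lt hα)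
  have h := hmono (∑ j, w j * α j + 1) m α (Nat.lt_succ_self _)
  rw [map_sub, sub_eq_zero] at h ⊢
  rw [hf]
  exact h.symm

/-- Hadamard's lemma, with weights. -/
theorem exists_eq_C_add_sum_X_mul [CharZero K] (hf : f ∈ weightIdeal K w d) :
    ∃ (c : K) (g : σ → MvPowerSeries σ K), f = MvPowerSeries.C c +
      ∑ i, MvPowerSeries.X i * g i ∧ ∀ i, g i ∈ weightIdeal K w (d - w i) := by
  classical
  let g : σ → MvPowerSeries σ K := fun i β => ((β i + 1 : ℕ) : K) / ((∑ j, β j + 1 : ℕ) : K) *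
    MvPowerSeries.coeff (β + Finsupp.single i 1) f
  have hg : ∀ i β, MvPowerSeries.coeff β (g i) = ((β i + 1 : ℕ) : K) / ((∑ j, β j + 1 : ℕ) : K) *
    MvPowerSeries.coeff (β + Finsupp.single i 1) f := fun _ _ => rfl
  refine ⟨MvPowerSeries.coeff 0 f, g, ?_, ?_⟩
  · ext α
    rw [map_add, map_sum, MvPowerSeries.coeff_C]
    by_cases h0 : α = 0
    · subst h0
      rw [if_pos rfl, Finset.sum_eq_zero fun i _ => MvPowerSeries.coeff_zero_X_mul _ _, add_zero]
    · rw [if_neg h0, zero_add]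
      have hne : ((∑ j, α j : ℕ) : K) ≠ 0 := by
        rw [Nat.cast_ne_zero]
        intro h
        exact h0 (Finsupp.ext fun j => Finset.sum_eq_zero_iff.mp h j (Finset.mem_univ j))
      have key : ∀ i, MvPowerSeries.coeff α (MvPowerSeries.X i * g i) =
          (α i : K) / ((∑ j, α j : ℕ) : K) * MvPowerSeries.coeff α f := by
        intro i
        rw [show (MvPowerSeries.X i : MvPowerSeries σ K) =
          MvPowerSeries.monomial (Finsupp.single i 1) 1 from rfl, MvPowerSeries.coeff_monomial_mul]
        split_ifs with h
        · obtain ⟨β, rfl⟩ := exists_add_of_le h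
          rw [add_tsub_cancel_left, one_mul, hg, add_comm (Finsupp.single i 1) β]
          simp [Finset.sum_add_distrib, Finsupp.single_apply]
        · have : α i = 0 := by
            by_contra h'
            exact h (Finsupp.single_le_iff.mpr (Nat.one_le_iff_ne_zero.mpr h'))
          simp [this]
      rw [Finset.sum_congr rfl fun i _ => key i, ← Finset.sum_mul, ← Finset.sum_div,
        ← Nat.cast_sum, div_self hne, one_mul]
  · intro i β hβ
    rw [hg, hf, mul_zero]
    rw [sum_weight_add_single]
    omega

/-- A derivation which raises weights on the generators raises weights everywhere. -/
theorem derivation_mem_weightIdeal [CharZero K] (hw : ∀ i, 1 ≤ w i)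
    (D : Derivation K (MvPowerSeries σ K) (MvPowerSeries σ K))
    (hD : ∀ i, D (MvPowerSeries.X i) ∈ weightIdeal K w (w i))
    (hf : f ∈ weightIdeal K w d) : D f ∈ weightIdeal K w d := by
  induction d using Nat.strong_induction_on generalizing f with
  | _ d ih =>
    rcases Nat.eq_zero_or_pos d with rfl | hd
    · exact weightIdeal_zero _
    obtain ⟨c, g, rfl, hg⟩ := exists_eq_C_add_sum_X_mul hf
    have hc : D (MvPowerSeries.C c) = 0 := D.map_algebraMap c
    rw [map_add, hc, zero_add, map_sum]
    refine sum_mem fun i _ => ?_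
    rw [D.leibniz, smul_eq_mul, smul_eq_mul]
    have hi := hw i
    refine add_mem
      (weightIdeal_antitone (by omega) (mul_mem_weightIdeal (X_mem_weightIdeal i)
        (ih (d - w i) (by omega) (hg i)))) ?_
    rw [mul_comm]
    exact weightIdeal_antitone (by omega) (mul_mem_weightIdeal (hD i) (hg i))

/-- An endomorphism which is the identity on generators up to higher weight is the identity up to
higher weight. -/
theorem algHom_sub_self_mem_weightIdeal [CharZero K] (hw : ∀ i, 1 ≤ w i)
    (ψ : MvPowerSeries σ K →ₐ[K] MvPowerSeries σ K)
    (hψ : ∀ i, ψ (MvPowerSeries.X i) - MvPowerSeries.X i ∈ weightIdeal K w (w i + 1))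
    (hf : f ∈ weightIdeal K w d) : ψ f - f ∈ weightIdeal K w (d + 1) := by
  induction d using Nat.strong_induction_on generalizing f with
  | _ d ih =>
    obtain ⟨c, g, rfl, hg⟩ := exists_eq_C_add_sum_X_mul hf
    have hc : ψ (MvPowerSeries.C c) = MvPowerSeries.C c := ψ.commutes c
    rw [map_add, hc, add_sub_add_left_eq_sub, map_sum, ← Finset.sum_sub_distrib]
    refine sum_mem fun i _ => ?_
    have hi := hw i
    have hsplit : ψ (MvPowerSeries.X i * g i) - MvPowerSeries.X i * g i =
        (ψ (MvPowerSeries.X i) - MvPowerSeries.X i) * ψ (g i) +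
          MvPowerSeries.X i * (ψ (g i) - g i) := by
      rw [map_mul]
      ring
    rw [hsplit]
    by_cases hd : d < w i
    · refine add_mem (weightIdeal_antitone (by omega) (Ideal.mul_mem_right _ _ (hψ i)))
        (weightIdeal_antitone (by omega) (Ideal.mul_mem_right _ _ (X_mem_weightIdeal i)))
    · have h := ih (d - w i) (by omega) (hg i)
      have h' : ψ (g i) ∈ weightIdeal K w (d - w i) := by
        have := add_mem (weightIdeal_antitone (Nat.le_succ _) h) (hg i)
        rwa [sub_add_cancel] at this
      exact add_mem (weightIdeal_antitone (by omega) (mul_mem_weightIdeal (hψ i) h'))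
        (weightIdeal_antitone (by omega) (mul_mem_weightIdeal (X_mem_weightIdeal i) h))

theorem bijective_of_sub_self_mem_weightIdeal [CharZero K] (hw : ∀ i, 1 ≤ w i)
    (ψ : MvPowerSeries σ K →ₐ[K] MvPowerSeries σ K)
    (hψ : ∀ i, ψ (MvPowerSeries.X i) - MvPowerSeries.X i ∈ weightIdeal K w (w i + 1)) :
    Function.Bijective ψ := by
  have hψ' : ∀ {d f}, f ∈ weightIdeal K w d → ψ f - f ∈ weightIdeal K w (d + 1) :=
    fun hf => algHom_sub_self_mem_weightIdeal hw ψ hψ hf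
  constructor
  · rw [injective_iff_map_eq_zero]
    intro f hf
    refine eq_zero_of_forall_mem_weightIdeal (w := w) fun d => ?_
    induction d with
    | zero => exact weightIdeal_zero f
    | succ d ih => simpa [hf] using hψ' ih
  · intro g
    let F : ℕ → MvPowerSeries σ K := fun k => Nat.rec 0 (fun _ f => f + (g - ψ f)) k
    have hF : ∀ k, F (k + 1) = F k + (g - ψ (F k)) := fun k => rfl
    have hFg : ∀ k, g - ψ (F k) ∈ weightIdeal K w k := by
      intro k
      induction k with
      | zero => exact weightIdeal_zero _
      | succ k ih =>
        have h := neg_mem (hψ' ih)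
        rw [hF, map_add]
        rwa [show g - (ψ (F k) + ψ (g - ψ (F k))) = -(ψ (g - ψ (F k)) - (g - ψ (F k))) by ring]
    obtain ⟨f, hf⟩ := exists_limit (w := w) F fun k => by
      rw [hF, add_sub_cancel_left]
      exact hFg k
    refine ⟨f, sub_eq_zero.mp (eq_zero_of_forall_mem_weightIdeal (w := w) fun k => ?_)⟩
    have h1 := add_mem (weightIdeal_antitone (Nat.le_succ k) (hψ' (hf k))) (hf k)
    rw [sub_add_cancel, map_sub] at h1
    have h2 := sub_mem h1 (hFg k)
    rwa [sub_sub_sub_cancel_right] at h2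

/-- Induction principle for quasi-homogeneous polynomials. -/
theorem quasiHomogeneous_induction {M : ℕ → MvPolynomial σ K → Prop}
    (hC : ∀ a, M 0 (MvPolynomial.C a)) (hzero : ∀ d, M d 0)
    (hadd : ∀ d p q, M d p → M d q → M d (p + q))
    (hmul : ∀ d p i, M d p → M (d + w i) (p * MvPolynomial.X i))
    {p : MvPolynomial σ K} (hp : ∀ β ∈ p.support, ∑ j, w j * β j = d) : M d p := by
  classical
  have hmon : ∀ (α : σ →₀ ℕ) (a : K), M (∑ j, w j * α j) (MvPolynomial.monomial α a) := by
    intro α a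
    induction α using Finsupp.induction with
    | zero => simpa using hC a
    | single_add i k α _ _ ih =>
      rw [add_comm]
      clear * - ih hmul
      induction k with
      | zero => simpa using ih
      | succ k ihk =>
        have h := hmul _ _ i ihk
        rw [sum_weight_add_single] at h ⊢
        rwa [MvPolynomial.X, MvPolynomial.monomial_mul, mul_one, add_assoc α, ← Finsupp.single_add,
          add_assoc (∑ j, w j * α j), ← Nat.mul_succ] at h
  rw [p.as_sum]
  refine Finset.sum_induction _ (M d) (hadd d) (hzero d) fun β hβ => ?_
  rw [← hp β hβ]
  exact hmon β _

theorem sum_mul_pderiv_mul_X (U : σ → MvPowerSeries σ K) (p : MvPolynomial σ K) (i : σ) :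
    ∑ j, U j * (MvPolynomial.pderiv j (p * MvPolynomial.X i) : MvPowerSeries σ K) =
      (p : MvPowerSeries σ K) * U i + (∑ j, U j * (MvPolynomial.pderiv j p : MvPowerSeries σ K)) *
        MvPowerSeries.X i := by
  classical
  simp only [MvPolynomial.pderiv_mul, MvPolynomial.pderiv_X, MvPolynomial.coe_add,
    MvPolynomial.coe_mul, MvPolynomial.coe_X, mul_add, Finset.sum_add_distrib, Finset.sum_mul]
  rw [add_comm]
  congr 1
  · rw [Finset.sum_eq_single i]
    · simp [mul_comm]
    · intro j _ hj
      simp [hj.symm]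
    · simp
  · exact Finset.sum_congr rfl fun j _ => by ring

/-- First order Taylor expansion of a quasi-homogeneous polynomial, up to higher weight. -/
theorem aeval_add_sub_mem_weightIdeal {F U : σ → MvPowerSeries σ K} {k : ℕ} (hk : 1 ≤ k)
    (hF : ∀ i, F i - MvPowerSeries.X i ∈ weightIdeal K w (w i + 1))
    (hU : ∀ i, U i ∈ weightIdeal K w (w i + k)) {p : MvPolynomial σ K}
    (hp : ∀ β ∈ p.support, ∑ j, w j * β j = d) :
    MvPolynomial.aeval (F + U) p - MvPolynomial.aeval F p -
      ∑ j, U j * (MvPolynomial.pderiv j p : MvPowerSeries σ K) ∈ weightIdeal K w (d + k + 1) := by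
  classical
  have hF' : ∀ i, F i ∈ weightIdeal K w (w i) := fun i => by
    have := add_mem (weightIdeal_antitone (Nat.le_succ _) (hF i)) (X_mem_weightIdeal i)
    rwa [sub_add_cancel] at this
  have hFU : ∀ i, (F + U) i - MvPowerSeries.X i ∈ weightIdeal K w (w i + 1) := fun i => by
    rw [Pi.add_apply, add_sub_right_comm]
    exact add_mem (hF i) (weightIdeal_antitone (by omega) (hU i))
  have hFU' : ∀ i, (F + U) i ∈ weightIdeal K w (w i) := fun i =>
    add_mem (hF' i) (weightIdeal_antitone (by omega) (hU i))
  let M (d : ℕ) (p : MvPolynomial σ K) : Prop :=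
    MvPolynomial.aeval (F + U) p ∈ weightIdeal K w d ∧
      MvPolynomial.aeval (F + U) p - (p : MvPowerSeries σ K) ∈ weightIdeal K w (d + 1) ∧
      ∑ j, U j * (MvPolynomial.pderiv j p : MvPowerSeries σ K) ∈ weightIdeal K w (d + k) ∧
      MvPolynomial.aeval (F + U) p - MvPolynomial.aeval F p -
      ∑ j, U j * (MvPolynomial.pderiv j p : MvPowerSeries σ K) ∈ weightIdeal K w (d + k + 1)
  suffices h : M d p from h.2.2.2
  refine quasiHomogeneous_induction (fun a => ?_) (fun d => ?_) (fun d p q hp hq => ?_)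
    (fun d p i hp => ?_) hp
  · simp [M, MvPowerSeries.algebraMap_apply, weightIdeal_zero]
  · simp [M]
  · simp only [M, map_add, MvPolynomial.coe_add, mul_add, Finset.sum_add_distrib]
    obtain ⟨h0, h1, h2, h3⟩ := hp
    obtain ⟨h0', h1', h2', h3'⟩ := hq
    refine ⟨add_mem h0 h0', ?_, add_mem h2 h2', ?_⟩
    · rw [add_sub_add_comm]
      exact add_mem h1 h1'
    · rw [add_sub_add_comm, add_sub_add_comm]
      exact add_mem h3 h3'
  · obtain ⟨h0, h1, h2, h3⟩ := hp
    simp only [M]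
    rw [sum_mul_pderiv_mul_X, map_mul, map_mul, MvPolynomial.aeval_X, MvPolynomial.aeval_X,
      MvPolynomial.coe_mul, MvPolynomial.coe_X]
    generalize MvPolynomial.aeval (F + U) p = A at h0 h1 h3 ⊢
    generalize MvPolynomial.aeval F p = B at h3 ⊢
    generalize ∑ j, U j * (MvPolynomial.pderiv j p : MvPowerSeries σ K) = T at h2 h3 ⊢
    generalize (p : MvPowerSeries σ K) = q at h1 ⊢
    refine ⟨mul_mem_weightIdeal h0 (hFU' i), ?_, ?_, ?_⟩
    · rw [show A * (F + U) i - q * MvPowerSeries.X i = A * ((F + U) i - MvPowerSeries.X i) +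
        (A - q) * MvPowerSeries.X i by ring]
      exact add_mem (weightIdeal_antitone (by omega) (mul_mem_weightIdeal h0 (hFU i)))
        (weightIdeal_antitone (by omega) (mul_mem_weightIdeal h1 (X_mem_weightIdeal i)))
    · have hq : q ∈ weightIdeal K w d := by
        have := sub_mem h0 (weightIdeal_antitone (Nat.le_succ d) h1)
        rwa [sub_sub_cancel] at this
      exact add_mem (weightIdeal_antitone (by omega) (mul_mem_weightIdeal hq (hU i)))
        (weightIdeal_antitone (by omega) (mul_mem_weightIdeal h2 (X_mem_weightIdeal i)))
    · rw [Pi.add_apply, show A * (F i + U i) - B * F i - (q * U i + T * MvPowerSeries.X i) =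
        (A - B - T) * F i + T * (F i - MvPowerSeries.X i) + (A - q) * U i by ring]
      exact add_mem (add_mem
        (weightIdeal_antitone (by omega) (mul_mem_weightIdeal h3 (hF' i)))
        (weightIdeal_antitone (by omega) (mul_mem_weightIdeal h2 (hF i))))
        (weightIdeal_antitone (by omega) (mul_mem_weightIdeal h1 (hU i)))

theorem derivation_coe (D : Derivation K (MvPowerSeries σ K) (MvPowerSeries σ K))
    (p : MvPolynomial σ K) : D (p : MvPowerSeries σ K) =
      ∑ j, D (MvPowerSeries.X j) * (MvPolynomial.pderiv j p : MvPowerSeries σ K) := by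
  classical
  induction p using MvPolynomial.induction_on with
  | C a =>
    rw [MvPolynomial.coe_C, show D (MvPowerSeries.C a) = 0 from D.map_algebraMap a]
    simp
  | add p q hp hq => simp [hp, hq, mul_add, Finset.sum_add_distrib]
  | mul_X p i hp =>
    rw [sum_mul_pderiv_mul_X, MvPolynomial.coe_mul, MvPolynomial.coe_X, D.leibniz, hp,
      smul_eq_mul, smul_eq_mul, mul_comm (MvPowerSeries.X i)]

/-- The quasi-homogeneous components of a power series are polynomials. -/
theorem exists_weight_component (hw : ∀ i, 1 ≤ w i) (f : MvPowerSeries σ K) (d : ℕ) :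
    ∃ p : MvPolynomial σ K, ∀ β, MvPolynomial.coeff β p =
      if ∑ j, w j * β j = d then MvPowerSeries.coeff β f else 0 := by
  classical
  refine ⟨∑ β ∈ Finset.Iic (Finsupp.equivFunOnFinite.symm fun _ => d),
    MvPolynomial.monomial β (if ∑ j, w j * β j = d then MvPowerSeries.coeff β f else 0),
    fun β => ?_⟩
  simp only [MvPolynomial.coeff_sum, MvPolynomial.coeff_monomial, Finset.sum_ite_eq',
    Finset.mem_Iic]
  split_ifs with h1 h2 h2 <;> try rfl
  refine absurd (fun i => ?_) h1
  calc β i ≤ w i * β i := Nat.le_mul_of_pos_left _ (hw i)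
    _ ≤ ∑ j, w j * β j := Finset.single_le_sum (f := fun j => w j * β j)
        (fun _ _ => Nat.zero_le _) (Finset.mem_univ i)
    _ = d := h2

/-- One step of the formal linearization: an approximate conjugacy is improved by solving the
homological equation. -/
theorem exists_improvement (hw : ∀ i, 1 ≤ w i)
    (D : Derivation K (MvPowerSeries σ K) (MvPowerSeries σ K)) (P : σ → MvPolynomial σ K)
    (hPw : ∀ i, ∀ β ∈ (P i).support, ∑ j, w j * β j = w i)
    (hDP : ∀ i, D (MvPowerSeries.X i) - P i ∈ weightIdeal K w (w i + 1)) {k : ℕ} (hk : 1 ≤ k)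
    (hsurj : ∀ Y : σ → MvPolynomial σ K,
      (∀ i, ∀ β ∈ (Y i).support, ∑ j, w j * β j = w i + k) →
      ∃ U : σ → MvPolynomial σ K, (∀ i, ∀ β ∈ (U i).support, ∑ j, w j * β j = w i + k) ∧
        ∀ i, ∑ j, (P j * MvPolynomial.pderiv j (U i) - U j * MvPolynomial.pderiv j (P i)) = Y i)
    (F : σ → MvPowerSeries σ K)
    (hF : ∀ i, F i - MvPowerSeries.X i ∈ weightIdeal K w (w i + 1))
    (hDF : ∀ i, D (F i) - MvPolynomial.aeval F (P i) ∈ weightIdeal K w (w i + k)) :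
    ∃ U : σ → MvPowerSeries σ K, (∀ i, U i ∈ weightIdeal K w (w i + k)) ∧
      ∀ i, D ((F + U) i) - MvPolynomial.aeval (F + U) (P i) ∈ weightIdeal K w (w i + k + 1) := by
  choose E hE using fun i => exists_weight_component hw
    (D (F i) - MvPolynomial.aeval F (P i)) (w i + k)
  obtain ⟨U, hU, hUE⟩ := hsurj (fun i => -E i) fun i β hβ => by
    by_contra h
    rw [MvPolynomial.support_neg, MvPolynomial.mem_support_iff, hE, if_neg h] at hβ
    exact hβ rfl
  have hU' : ∀ i, (U i : MvPowerSeries σ K) ∈ weightIdeal K w (w i + k) := fun i =>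
    coe_mem_weightIdeal fun β hβ => (hU i β hβ).ge
  refine ⟨fun i => U i, hU', fun i => ?_⟩
  have h1 : D (F i) - MvPolynomial.aeval F (P i) - E i ∈ weightIdeal K w (w i + k + 1) := by
    intro α hα
    rw [map_sub, MvPolynomial.coeff_coe, hE]
    split_ifs with h
    · exact sub_self _
    · rw [sub_zero]
      exact hDF i α (by omega)
  have h2 := aeval_add_sub_mem_weightIdeal hk hF hU' (hPw i)
  have h3 : ∑ j, (D (MvPowerSeries.X j) - P j) *
      (MvPolynomial.pderiv j (U i) : MvPowerSeries σ K) ∈ weightIdeal K w (w i + k + 1) :=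
    sum_mem fun j _ => weightIdeal_antitone (by omega)
      (mul_mem_weightIdeal (hDP j) (coe_pderiv_mem_weightIdeal (fun β hβ => (hU i β hβ).ge) j))
  have h4 : ∑ j, ((P j : MvPowerSeries σ K) * (MvPolynomial.pderiv j (U i) : MvPolynomial σ K) -
      U j * (MvPolynomial.pderiv j (P i) : MvPolynomial σ K)) = -E i := by
    have := congrArg (MvPolynomial.coeToMvPowerSeries.ringHom (R := K) (σ := σ)) (hUE i)
    simpa only [map_sum, map_sub, map_mul, map_neg,
      MvPolynomial.coeToMvPowerSeries.ringHom_apply] using this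
  convert add_mem (sub_mem h1 h2) h3 using 1
  simp only [sub_mul, Finset.sum_sub_distrib] at h4 ⊢
  rw [Pi.add_apply, map_add, derivation_coe]
  linear_combination h4

/-- The conjugacy equation has a formal solution tangent to the identity. -/
theorem exists_conjugacy [CharZero K] (hw : ∀ i, 1 ≤ w i)
    (D : Derivation K (MvPowerSeries σ K) (MvPowerSeries σ K)) (P : σ → MvPolynomial σ K)
    (hD : ∀ i, D (MvPowerSeries.X i) ∈ weightIdeal K w (w i))
    (hPw : ∀ i, ∀ β ∈ (P i).support, ∑ j, w j * β j = w i)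
    (hDP : ∀ i, D (MvPowerSeries.X i) - P i ∈ weightIdeal K w (w i + 1))
    (hsurj : ∀ k, 1 ≤ k → ∀ Y : σ → MvPolynomial σ K,
      (∀ i, ∀ β ∈ (Y i).support, ∑ j, w j * β j = w i + k) →
      ∃ U : σ → MvPolynomial σ K, (∀ i, ∀ β ∈ (U i).support, ∑ j, w j * β j = w i + k) ∧
        ∀ i, ∑ j, (P j * MvPolynomial.pderiv j (U i) - U j * MvPolynomial.pderiv j (P i)) = Y i) :
    ∃ F : σ → MvPowerSeries σ K,
      (∀ i, F i - MvPowerSeries.X i ∈ weightIdeal K w (w i + 1)) ∧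
      ∀ i, D (F i) = MvPolynomial.aeval F (P i) := by
  let S (k : ℕ) (F : σ → MvPowerSeries σ K) : Prop :=
    (∀ i, F i - MvPowerSeries.X i ∈ weightIdeal K w (w i + 1)) ∧
      ∀ i, D (F i) - MvPolynomial.aeval F (P i) ∈ weightIdeal K w (w i + (k + 1))
  have hstep : ∀ k (F : {F // S k F}), ∃ G : {G // S (k + 1) G},
      ∀ i, G.1 i - F.1 i ∈ weightIdeal K w (w i + (k + 1)) := by
    rintro k ⟨F, hF, hDF⟩
    obtain ⟨U, hU, hDU⟩ := exists_improvement hw D P hPw hDP (Nat.le_add_left 1 k)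
      (hsurj _ (Nat.le_add_left 1 k)) F hF hDF
    refine ⟨⟨F + U, fun i => ?_, hDU⟩, fun i => ?_⟩
    · rw [Pi.add_apply, add_sub_right_comm]
      exact add_mem (hF i) (weightIdeal_antitone (by omega) (hU i))
    · change (F + U) i - F i ∈ _
      rw [Pi.add_apply, add_sub_cancel_left]
      exact hU i
  choose next hnext using hstep
  have hinit : S 0 MvPowerSeries.X := by
    refine ⟨fun i => by simp, fun i => ?_⟩
    have h : MvPolynomial.aeval (MvPowerSeries.X : σ → MvPowerSeries σ K) (P i) = P i := by
      have := congrArg (fun ψ => ψ (P i)) (MvPolynomial.aeval_unique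
        (MvPolynomial.coeToMvPowerSeries.algHom (σ := σ) (R := K) K))
      simpa [Function.comp_def] using this.symm
    rw [h]
    exact hDP i
  let F : (k : ℕ) → {F // S k F} := fun k => Nat.rec ⟨_, hinit⟩ next k
  have hF : ∀ k i, (F (k + 1)).1 i - (F k).1 i ∈ weightIdeal K w (w i + (k + 1)) :=
    fun k i => hnext k (F k) i
  choose G hG using fun i => exists_limit (w := w) (fun k => (F k).1 i)
    fun k => weightIdeal_antitone (by omega) (hF k i)
  refine ⟨G, fun i => ?_, fun i => sub_eq_zero.mp
    (eq_zero_of_forall_mem_weightIdeal (w := w) fun k => ?_)⟩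
  · have h := add_mem (hG i (w i + 1)) ((F (w i + 1)).2.1 i)
    rwa [sub_add_sub_cancel] at h
  · have h1 := derivation_mem_weightIdeal hw D hD (hG i k)
    have h2 := weightIdeal_antitone (by omega : k ≤ _) ((F k).2.2 i)
    have h3 := aeval_sub_aeval_mem (weightIdeal K w k) (fun j => hG j k) (P i)
    rw [map_sub] at h1
    convert sub_mem (add_mem h1 h2) h3 using 1
    ring

end WeightedLinearization

/-- **Formal weighted linearizability from invertibility of the homological operator.**
Let `K` be a field of characteristic zero, `w` a weighting of `K^n`, `D` a
`w`-admissible `K`-linear derivation of `R = MvPowerSeries (Fin n) K` with weighted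
linear approximation components `P^i ∈ MvPolynomial (Fin n) K`.  Suppose that for every
`k ≥ 1`, the adjoint operator `ad_P` is bijective on quasi-homogeneous polynomial vector
fields of weighted degree `k`.  Then there exists a `K`-algebra automorphism `φ` of `R`
such that `φ (D (φ⁻¹ x^i)) = P^i` for every `i`. -/
theorem formal_weighted_linearization_of_adjoint_bijective
    (K : Type*) [Field K] [CharZero K] (n : ℕ)
    (w : Fin n → ℕ) (hw1 : ∀ i, 1 ≤ w i) (hwmono : Monotone w)
    (D : Derivation K (MvPowerSeries (Fin n) K) (MvPowerSeries (Fin n) K))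
    (hadm : ∀ (i : Fin n) (α : Fin n →₀ ℕ), (∑ j, w j * α j) < w i →
      MvPowerSeries.coeff α (D (MvPowerSeries.X i)) = 0)
    (P : Fin n → MvPolynomial (Fin n) K)
    (hP : ∀ (i : Fin n) (α : Fin n →₀ ℕ),
      MvPolynomial.coeff α (P i) =
        if (∑ j, w j * α j) = w i then MvPowerSeries.coeff α (D (MvPowerSeries.X i))
        else 0)
    (hbij : ∀ k : ℕ, 1 ≤ k →
      ∀ Y : Fin n → MvPolynomial (Fin n) K,
        (∀ (i : Fin n), ∀ β ∈ (Y i).support, (∑ j, w j * β j) = w i + k) →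
        ∃! U : Fin n → MvPolynomial (Fin n) K,
          (∀ (i : Fin n), ∀ β ∈ (U i).support, (∑ j, w j * β j) = w i + k) ∧
          (∀ i : Fin n,
            (∑ j, (P j * MvPolynomial.pderiv j (U i) - U j * MvPolynomial.pderiv j (P i)))
              = Y i)) :
    ∃ φ : MvPowerSeries (Fin n) K ≃ₐ[K] MvPowerSeries (Fin n) K,
      ∀ i : Fin n, φ (D (φ.symm (MvPowerSeries.X i))) = (P i : MvPowerSeries (Fin n) K) := by
  have hDP : ∀ i, D (MvPowerSeries.X i) - P i ∈
      WeightedLinearization.weightIdeal K w (w i + 1) := fun i α hα => by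
    rw [map_sub, MvPolynomial.coeff_coe, hP]
    split_ifs with h
    · exact sub_self _
    · rw [sub_zero]
      exact hadm i α (by omega)
  have hPw : ∀ i, ∀ β ∈ (P i).support, ∑ j, w j * β j = w i := fun i β hβ => by
    by_contra h
    rw [MvPolynomial.mem_support_iff, hP, if_neg h] at hβ
    exact hβ rfl
  obtain ⟨F, hF, hDF⟩ := WeightedLinearization.exists_conjugacy hw1 D P hadm hPw hDP
    fun k hk Y hY => (hbij k hk Y hY).exists
  have hsubst : MvPowerSeries.HasSubst F :=
    MvPowerSeries.hasSubst_of_constantCoeff_zero fun i => by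
      have h := hF i 0 (by simp)
      rwa [map_sub, MvPowerSeries.coeff_zero_X, sub_zero] at h
  let ψ : MvPowerSeries (Fin n) K →ₐ[K] MvPowerSeries (Fin n) K :=
    MvPowerSeries.substAlgHom hsubst
  have hψX : ∀ i, ψ (MvPowerSeries.X i) = F i := MvPowerSeries.substAlgHom_X hsubst
  have hψ : Function.Bijective ψ :=
    WeightedLinearization.bijective_of_sub_self_mem_weightIdeal hw1 ψ fun i => by
      rw [hψX]
      exact hF i
  refine ⟨(AlgEquiv.ofBijective ψ hψ).symm, fun i => ?_⟩
  rw [AlgEquiv.symm_symm, AlgEquiv.symm_apply_eq, AlgEquiv.coe_ofBijective, hψX, hDF]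
  exact (MvPowerSeries.substAlgHom_coe hsubst (P i)).symm
end

section
/- Let K be a field of characteristic zero, w a weighting of K^n, and X a K-linear derivation of R = MvPowerSeries (Fin n) K that is weighted Euler-like with respect to w: for every i and every finitely supported multi-index α : Fin n → ℕ with ⟨w,α⟩ ≤ w i, the coefficient of x^α in X(x^i) equals (w i : K) if α = e_i and equals 0 otherwise. Then there exists a K-algebra automorphism φ of R such that φ∘X = E_w∘φ, i.e. for every f ∈ R and every multi-index α, coeff_α(φ(X(f))) = (⟨w,α⟩ : K) · coeff_α(φ(f)). -/
open MvPowerSeries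

namespace WeightedEuler

variable {K : Type*} [Field K] {n : ℕ}

/-- The weight `⟨w, α⟩` of a multi-index. -/
def wt (w : Fin n → ℕ) (α : Fin n →₀ ℕ) : ℕ := ∑ j, w j * α j

lemma wt_add (w : Fin n → ℕ) (α β : Fin n →₀ ℕ) : wt w (α + β) = wt w α + wt w β := by
  simp [wt, mul_add, Finset.sum_add_distrib]

lemma wt_single (w : Fin n → ℕ) (i : Fin n) : wt w (Finsupp.single i 1) = w i := by
  simp [wt, Finsupp.single_apply]

/-- The power series all of whose monomials have weight at least `k`. -/
def filt (K : Type*) [Field K] (w : Fin n → ℕ) (k : ℕ) :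
    Submodule K (MvPowerSeries (Fin n) K) where
  carrier := {f | ∀ α, wt w α < k → coeff α f = 0}
  add_mem' hf hg α hα := by rw [map_add, hf α hα, hg α hα, add_zero]
  zero_mem' α _ := map_zero _
  smul_mem' c f hf α hα := by rw [map_smul, hf α hα, smul_zero]

lemma mem_filt {w : Fin n → ℕ} {k : ℕ} {f : MvPowerSeries (Fin n) K} :
    f ∈ filt K w k ↔ ∀ α, wt w α < k → coeff α f = 0 := Iff.rfl

lemma mem_filt_zero (w : Fin n → ℕ) (f : MvPowerSeries (Fin n) K) : f ∈ filt K w 0 :=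
  fun _ h => absurd h (Nat.not_lt_zero _)

lemma filt_anti (w : Fin n → ℕ) {a b : ℕ} (h : a ≤ b) : filt K w b ≤ filt K w a :=
  fun _ hf α hα => hf α (hα.trans_le h)

lemma mul_mem_filt {w : Fin n → ℕ} {a b : ℕ} {f g : MvPowerSeries (Fin n) K}
    (hf : f ∈ filt K w a) (hg : g ∈ filt K w b) : f * g ∈ filt K w (a + b) := by
  classical
  intro α hα
  rw [coeff_mul]
  refine Finset.sum_eq_zero fun p hp => ?_
  rw [← Finset.HasAntidiagonal.mem_antidiagonal.mp hp, wt_add] at hα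
  rcases lt_or_ge (wt w p.1) a with h | h
  · rw [hf _ h, zero_mul]
  · rw [hg _ (by omega), mul_zero]

lemma X_mem_filt (w : Fin n → ℕ) (i : Fin n) :
    (X i : MvPowerSeries (Fin n) K) ∈ filt K w (w i) := by
  classical
  intro α hα
  rw [coeff_X, if_neg]
  rintro rfl
  exact hα.ne (wt_single w i)

lemma eq_zero_of_forall_mem_filt {w : Fin n → ℕ} {f : MvPowerSeries (Fin n) K}
    (h : ∀ k, f ∈ filt K w k) : f = 0 := by
  ext α
  exact h (wt w α + 1) α (Nat.lt_succ_self _)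

/-- A `K`-linear map acts on the associated graded pieces as the Euler vector field does. -/
def ActsAsWeight (w : Fin n → ℕ)
    (D : MvPowerSeries (Fin n) K →ₗ[K] MvPowerSeries (Fin n) K) : Prop :=
  ∀ (k : ℕ), ∀ f ∈ filt K w k, D f - (k : K) • f ∈ filt K w (k + 1)

/-- Splitting off the multiples of one variable. -/
lemma exists_eq_X_mul_add (i : Fin n) (f : MvPowerSeries (Fin n) K) :
    ∃ g h : MvPowerSeries (Fin n) K, f = X i * g + h ∧
      (∀ α, coeff α g = coeff (Finsupp.single i 1 + α) f) ∧
      (∀ α, coeff α h = if α i = 0 then coeff α f else 0) := by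
  classical
  obtain ⟨g, hg⟩ : ∃ g : MvPowerSeries (Fin n) K,
      ∀ α, coeff α g = coeff (Finsupp.single i 1 + α) f := ⟨fun α => _, fun _ => rfl⟩
  obtain ⟨h, hh⟩ : ∃ h : MvPowerSeries (Fin n) K,
      ∀ α, coeff α h = if α i = 0 then coeff α f else 0 := ⟨fun α => _, fun _ => rfl⟩
  refine ⟨g, h, ?_, hg, hh⟩
  ext α
  rw [map_add, X, coeff_monomial_mul, one_mul, hh, hg]
  have hle : Finsupp.single i 1 ≤ α ↔ α i ≠ 0 := by
    rw [Finsupp.single_le_iff, Nat.one_le_iff_ne_zero]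
  by_cases hα : α i = 0
  · rw [if_neg (by rw [hle]; simpa using hα), if_pos hα, zero_add]
  · rw [if_pos (hle.mpr hα), if_neg hα, add_zero, add_tsub_cancel_of_le (hle.mpr hα)]

lemma actsAsWeight_of_derivation {w : Fin n → ℕ} (hw : ∀ i, 1 ≤ w i)
    (D : Derivation K (MvPowerSeries (Fin n) K) (MvPowerSeries (Fin n) K))
    (hD : ∀ i, D (X i) - (w i : K) • X i ∈ filt K w (w i + 1)) :
    ActsAsWeight w (D : MvPowerSeries (Fin n) K →ₗ[K] MvPowerSeries (Fin n) K) := by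
  classical
  intro k
  induction k using Nat.strong_induction_on with
  | _ k ih =>
  suffices H : ∀ (s : Finset (Fin n)), ∀ f ∈ filt K w k,
      (∀ α, (∃ i, i ∉ s ∧ α i ≠ 0) → coeff α f = 0) →
      D f - (k : K) • f ∈ filt K w (k + 1) from
    fun f hf => H Finset.univ f hf fun α ⟨i, hi, _⟩ => absurd (Finset.mem_univ i) hi
  intro s
  induction s using Finset.induction_on with
  | empty =>
    intro f hf hs
    have hC : f = algebraMap K _ (coeff 0 f) := by
      ext α
      rw [MvPowerSeries.algebraMap_apply, Algebra.algebraMap_self, RingHom.id_apply, coeff_C]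
      split_ifs with h
      · rw [h]
      · obtain ⟨i, hi⟩ := Finsupp.ne_iff.mp h
        exact hs α ⟨i, Finset.notMem_empty i, hi⟩
    have hDf : D f = 0 := by rw [hC, D.map_algebraMap]
    rw [hDf, zero_sub]
    refine Submodule.neg_mem _ fun α hα => ?_
    rw [map_smul, smul_eq_mul]
    rcases Nat.eq_zero_or_pos k with rfl | hk
    · simp
    · rw [hC, hf 0 (by simpa [wt] using hk)]
      simp
  | insert i s hi hs =>
    intro f hf hsupp
    obtain ⟨g, h, hfgh, hg, hh⟩ := exists_eq_X_mul_add i f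
    have hhmem : h ∈ filt K w k := fun α hα => by
      rw [hh, hf α hα, ite_self]
    have h1 : D h - (k : K) • h ∈ filt K w (k + 1) := by
      refine hs h hhmem fun α ⟨j, hj, hαj⟩ => ?_
      rw [hh]
      split_ifs with hαi
      · refine hsupp α ⟨j, ?_, hαj⟩
        rw [Finset.mem_insert, not_or]
        exact ⟨fun hji => hαj (hji ▸ hαi), hj⟩
      · rfl
    have h2 : D (X i * g) - (k : K) • (X i * g) ∈ filt K w (k + 1) := by
      rw [D.leibniz, smul_eq_mul, smul_eq_mul]
      have hDX : D (X i) ∈ filt K w (w i) := by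
        have := Submodule.add_mem _ (filt_anti w (Nat.le_succ _) (hD i))
          (Submodule.smul_mem _ (w i : K) (X_mem_filt w i))
        rwa [sub_add_cancel] at this
      rcases lt_or_ge k (w i) with hk | hk
      · refine filt_anti w (Nat.succ_le_of_lt hk) ?_
        have e0 := mem_filt_zero (K := K) w
        refine Submodule.sub_mem _ (Submodule.add_mem _ ?_ ?_) (Submodule.smul_mem _ _ ?_)
        · exact mul_mem_filt (X_mem_filt w i) (e0 _)
        · simpa using mul_mem_filt (e0 g) hDX
        · exact mul_mem_filt (X_mem_filt w i) (e0 _)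
      · obtain ⟨l, rfl⟩ := Nat.exists_eq_add_of_le hk
        have hgl : g ∈ filt K w l := fun α hα => by
          rw [hg]
          refine hf _ ?_
          rw [wt_add, wt_single]
          omega
        have e1 := mul_mem_filt (X_mem_filt w i) (ih l (by have := hw i; omega) g hgl)
        have e2 := mul_mem_filt hgl (hD i)
        rw [show w i + (l + 1) = w i + l + 1 by omega] at e1
        rw [show l + (w i + 1) = w i + l + 1 by omega] at e2
        convert Submodule.add_mem _ e1 e2 using 1
        simp only [Derivation.coeFn_coe, smul_eq_C_mul, Nat.cast_add, map_add]
        ring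
    rw [hfgh]
    convert Submodule.add_mem _ h2 h1 using 1
    rw [map_add, smul_add]
    abel

section Intertwiner

variable {w : Fin n → ℕ} {D : MvPowerSeries (Fin n) K →ₗ[K] MvPowerSeries (Fin n) K}

lemma ActsAsWeight.map_mem (hD : ActsAsWeight w D) {k : ℕ} {f : MvPowerSeries (Fin n) K}
    (hf : f ∈ filt K w k) : D f ∈ filt K w k := by
  have := Submodule.add_mem _ (filt_anti w (Nat.le_succ _) (hD k f hf))
    (Submodule.smul_mem _ (k : K) hf)
  rwa [sub_add_cancel] at this

/-- The falling factorial `D (D - 1) ⋯ (D - (k - 1))`. -/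
def fallingProd (D : MvPowerSeries (Fin n) K →ₗ[K] MvPowerSeries (Fin n) K) :
    ℕ → MvPowerSeries (Fin n) K →ₗ[K] MvPowerSeries (Fin n) K
  | 0 => LinearMap.id
  | k + 1 => (D - (k : K) • LinearMap.id) ∘ₗ fallingProd D k

lemma fallingProd_succ (k : ℕ) (f : MvPowerSeries (Fin n) K) :
    fallingProd D (k + 1) f = D (fallingProd D k f) - (k : K) • fallingProd D k f := rfl

lemma fallingProd_comm (k : ℕ) (f : MvPowerSeries (Fin n) K) :
    fallingProd D k (D f) = D (fallingProd D k f) := by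
  induction k with
  | zero => rfl
  | succ k ih => rw [fallingProd_succ, fallingProd_succ, ih, map_sub, map_smul]

lemma ActsAsWeight.fallingProd_mem (hD : ActsAsWeight w D) (k : ℕ)
    (f : MvPowerSeries (Fin n) K) : fallingProd D k f ∈ filt K w k := by
  induction k with
  | zero => exact mem_filt_zero w _
  | succ k ih => exact hD k _ ih

lemma ActsAsWeight.fallingProd_sub_mem (hD : ActsAsWeight w D) {k : ℕ}
    {f : MvPowerSeries (Fin n) K} (hf : f ∈ filt K w k) {m : ℕ} (hm : m ≤ k) :
    fallingProd D m f - (k.descFactorial m : K) • f ∈ filt K w (k + 1) := by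
  induction m with
  | zero =>
    simp [fallingProd]
  | succ m ih =>
    have h := ih (by omega)
    have h1 := Submodule.sub_mem _ (hD.map_mem h) (Submodule.smul_mem _ (m : K) h)
    have h2 := Submodule.smul_mem _ (k.descFactorial m : K) (hD k f hf)
    convert Submodule.add_mem _ h1 h2 using 1
    rw [fallingProd_succ, Nat.descFactorial_succ, map_sub, map_smul, Nat.cast_mul,
      Nat.cast_sub (by omega : m ≤ k)]
    module

lemma ActsAsWeight.fallingProd_mem_of_mem (hD : ActsAsWeight w D) {k : ℕ}
    {f : MvPowerSeries (Fin n) K} (hf : f ∈ filt K w k) (m : ℕ) :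
    fallingProd D m f ∈ filt K w k := by
  induction m with
  | zero => exact hf
  | succ m ih => exact Submodule.sub_mem _ (hD.map_mem ih) (Submodule.smul_mem _ _ ih)

/-- The linear map whose weight `k` component is the projection to the `k`-eigenspace of `D`
followed by taking the weight `k` part. -/
noncomputable def intertwiner (w : Fin n → ℕ)
    (D : MvPowerSeries (Fin n) K →ₗ[K] MvPowerSeries (Fin n) K) :
    MvPowerSeries (Fin n) K →ₗ[K] MvPowerSeries (Fin n) K where
  toFun f := fun α => ((wt w α).factorial : K)⁻¹ * coeff α (fallingProd D (wt w α) f)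
  map_add' f g := by
    funext α
    simp only [map_add, mul_add]
    rfl
  map_smul' c f := by
    funext α
    simp only [map_smul, smul_eq_mul, mul_left_comm _ c]
    rfl

lemma coeff_intertwiner (f : MvPowerSeries (Fin n) K) (α : Fin n →₀ ℕ) :
    coeff α (intertwiner w D f) =
      ((wt w α).factorial : K)⁻¹ * coeff α (fallingProd D (wt w α) f) := rfl

lemma ActsAsWeight.coeff_intertwiner_map (hD : ActsAsWeight w D)
    (f : MvPowerSeries (Fin n) K) (α : Fin n →₀ ℕ) :
    coeff α (intertwiner w D (D f)) = (wt w α : K) * coeff α (intertwiner w D f) := by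
  have h := hD _ _ (hD.fallingProd_mem (wt w α) f) α (Nat.lt_succ_self _)
  rw [map_sub, map_smul, smul_eq_mul, sub_eq_zero] at h
  rw [coeff_intertwiner, coeff_intertwiner, fallingProd_comm, h]
  ring

lemma ActsAsWeight.intertwiner_sub_mem [CharZero K] (hD : ActsAsWeight w D) {k : ℕ}
    {f : MvPowerSeries (Fin n) K} (hf : f ∈ filt K w k) :
    intertwiner w D f - f ∈ filt K w (k + 1) := by
  intro α hα
  rw [map_sub, coeff_intertwiner]
  rcases (Nat.lt_succ_iff.mp hα).lt_or_eq with h | h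
  · rw [hf α h, hD.fallingProd_mem_of_mem hf _ α h, mul_zero, sub_zero]
  · have h1 := hD.fallingProd_sub_mem hf le_rfl α hα
    rw [map_sub, map_smul, smul_eq_mul, Nat.descFactorial_self, sub_eq_zero] at h1
    rw [h, h1, inv_mul_cancel_left₀ (Nat.cast_ne_zero.mpr (Nat.factorial_ne_zero k)), sub_self]

end Intertwiner

/-- A `K`-linear map that raises the filtration after subtracting the identity is bijective. -/
lemma bijective_of_sub_mem {w : Fin n → ℕ}
    (φ : MvPowerSeries (Fin n) K →ₗ[K] MvPowerSeries (Fin n) K)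
    (hφ : ∀ k, ∀ f ∈ filt K w k, φ f - f ∈ filt K w (k + 1)) : Function.Bijective φ := by
  constructor
  · rw [injective_iff_map_eq_zero]
    intro f hf
    refine eq_zero_of_forall_mem_filt (w := w) fun k => ?_
    induction k with
    | zero => exact mem_filt_zero w f
    | succ k ih =>
      have := hφ k f ih
      rwa [hf, zero_sub, Submodule.neg_mem_iff] at this
  · intro g
    let s : ℕ → MvPowerSeries (Fin n) K := fun m => Nat.rec 0 (fun _ f => f + (g - φ f)) m
    have hs : ∀ m, s (m + 1) = s m + (g - φ (s m)) := fun _ => rfl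
    have herr : ∀ m, g - φ (s m) ∈ filt K w m := by
      intro m
      induction m with
      | zero => exact mem_filt_zero w _
      | succ m ih =>
        have := Submodule.neg_mem _ (hφ m _ ih)
        convert this using 1
        rw [hs, map_add]
        abel
    have hcauchy : ∀ m d, s (m + d) - s m ∈ filt K w m := by
      intro m d
      induction d with
      | zero => simp
      | succ d ih =>
        have := Submodule.add_mem _ ih (filt_anti w (Nat.le_add_right m d) (herr (m + d)))
        convert this using 1
        rw [← add_assoc, hs]
        abel
    let f : MvPowerSeries (Fin n) K := fun α => coeff α (s (wt w α + 1))
    have hf : ∀ m, f - s m ∈ filt K w m := by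
      intro m α hα
      obtain ⟨d, rfl⟩ := Nat.exists_eq_add_of_le (Nat.succ_le_of_lt hα)
      have := hcauchy (wt w α + 1) d α (Nat.lt_succ_self _)
      rw [map_sub, sub_eq_zero] at this ⊢
      exact this.symm
    refine ⟨f, (sub_eq_zero.mp (eq_zero_of_forall_mem_filt (w := w) fun m => ?_)).symm⟩
    have h1 := hφ m _ (hf m)
    have h2 := Submodule.add_mem _ (filt_anti w (Nat.le_succ m) h1) (hf m)
    convert Submodule.sub_mem _ (herr m) h2 using 1
    rw [map_sub]
    abel

/-- A `K`-linear map that is the identity on the associated graded pieces and intertwines a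
derivation with the weighted Euler vector field is multiplicative. -/
lemma map_mul_of_intertwines [CharZero K] {w : Fin n → ℕ}
    (D : Derivation K (MvPowerSeries (Fin n) K) (MvPowerSeries (Fin n) K))
    (hD : ActsAsWeight w (D : MvPowerSeries (Fin n) K →ₗ[K] MvPowerSeries (Fin n) K))
    (φ : MvPowerSeries (Fin n) K →ₗ[K] MvPowerSeries (Fin n) K)
    (hφ : ∀ k, ∀ f ∈ filt K w k, φ f - f ∈ filt K w (k + 1))
    (hφD : ∀ f α, coeff α (φ (D f)) = (wt w α : K) * coeff α (φ f))
    (f g : MvPowerSeries (Fin n) K) : φ (f * g) = φ f * φ g := by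
  classical
  ext α
  suffices H : ∀ d i j, wt w α ≤ i + j + d → ∀ f ∈ filt K w i, ∀ g ∈ filt K w j,
      coeff α (φ (f * g)) = coeff α (φ f * φ g) from
    H (wt w α) 0 0 (by omega) f (mem_filt_zero w f) g (mem_filt_zero w g)
  have hφmem : ∀ k, ∀ f ∈ filt K w k, φ f ∈ filt K w k := fun k f hf => by
    have := Submodule.add_mem _ (filt_anti w (Nat.le_succ _) (hφ k f hf)) hf
    rwa [sub_add_cancel] at this
  have hbase : ∀ i j, wt w α ≤ i + j → ∀ f ∈ filt K w i, ∀ g ∈ filt K w j,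
      coeff α (φ (f * g)) = coeff α (φ f * φ g) := by
    intro i j hij f hf g hg
    have e1 := hφ _ _ (mul_mem_filt hf hg)
    have e2 := mul_mem_filt (hφ i f hf) (hφmem j g hg)
    have e3 := mul_mem_filt hf (hφ j g hg)
    rw [show i + 1 + j = i + j + 1 by omega] at e2
    have e := Submodule.sub_mem _ e1 (Submodule.add_mem _ e2 e3) α (by omega)
    rw [← sub_eq_zero, ← map_sub, ← e]
    congr 1
    ring
  intro d
  induction d with
  | zero => exact hbase
  | succ d ih =>
    intro i j hij f hf g hg
    rcases le_or_gt (wt w α) (i + j) with h | h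
    · exact hbase i j h f hf g hg
    have hDf := ih (i + 1) j (by omega) _ (hD i f hf) g hg
    have hDg := ih i (j + 1) (by omega) f hf _ (hD j g hg)
    have hprod : coeff α (φ (D f) * φ g) + coeff α (φ f * φ (D g)) =
        (wt w α : K) * coeff α (φ f * φ g) := by
      rw [coeff_mul, coeff_mul, coeff_mul, ← Finset.sum_add_distrib, Finset.mul_sum]
      refine Finset.sum_congr rfl fun p hp => ?_
      rw [hφD, hφD, ← Finset.HasAntidiagonal.mem_antidiagonal.mp hp, wt_add, Nat.cast_add]
      ring
    have hleib := hφD (f * g) α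
    rw [D.leibniz, smul_eq_mul, smul_eq_mul, mul_comm g, map_add, map_add] at hleib
    simp only [Derivation.coeFn_coe, sub_mul, mul_sub, smul_mul_assoc, mul_smul_comm, map_sub,
      map_smul, smul_eq_mul] at hDf hDg
    have hne : (wt w α : K) - i - j ≠ 0 := by
      rw [sub_sub, sub_ne_zero, ← Nat.cast_add]
      exact_mod_cast h.ne'
    refine mul_left_cancel₀ hne ?_
    linear_combination hDf + hDg + hprod - hleib

end WeightedEuler

open WeightedEuler


/-- **Formal linearization of weighted Euler-like vector fields.**
Let `K` be a field of characteristic zero, `w` a weighting of `K^n`, and `D` a `K`-linear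
derivation of `R = MvPowerSeries (Fin n) K` that is weighted Euler-like with respect to
`w`: for every `i` and every multi-index `α` with `⟨w,α⟩ ≤ w i`, the coefficient of `x^α`
in `D(x^i)` is `w i` if `α = e_i` and `0` otherwise.  Then there is a `K`-algebra
automorphism `φ` of `R` with `φ ∘ D = E_w ∘ φ`, where `E_w` is the weighted Euler vector
field, i.e. `coeff α (φ (D f)) = ⟨w,α⟩ · coeff α (φ f)` for all `f` and `α`. -/
theorem weighted_euler_like_linearizable
    (K : Type*) [Field K] [CharZero K] (n : ℕ)
    (w : Fin n → ℕ) (hw1 : ∀ i, 1 ≤ w i) (hwmono : Monotone w)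
    (D : Derivation K (MvPowerSeries (Fin n) K) (MvPowerSeries (Fin n) K))
    (hD : ∀ (i : Fin n) (α : Fin n →₀ ℕ), (∑ j, w j * α j) ≤ w i →
      MvPowerSeries.coeff α (D (MvPowerSeries.X i)) =
        if α = Finsupp.single i 1 then (w i : K) else 0) :
    ∃ φ : MvPowerSeries (Fin n) K ≃ₐ[K] MvPowerSeries (Fin n) K,
      ∀ (f : MvPowerSeries (Fin n) K) (α : Fin n →₀ ℕ),
        MvPowerSeries.coeff α (φ (D f)) =
          ((∑ j, w j * α j : ℕ) : K) * MvPowerSeries.coeff α (φ f) := by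
  have hX : ∀ i, D (X i) - (w i : K) • X i ∈ filt K w (w i + 1) := by
    classical
    intro i α hα
    rw [map_sub, map_smul, hD i α (Nat.lt_succ_iff.mp hα), coeff_X]
    split_ifs <;> simp
  have hDw := actsAsWeight_of_derivation hw1 D hX
  let φ := intertwiner w (D : MvPowerSeries (Fin n) K →ₗ[K] MvPowerSeries (Fin n) K)
  have hφ : ∀ k, ∀ f ∈ filt K w k, φ f - f ∈ filt K w (k + 1) :=
    fun _ _ hf => hDw.intertwiner_sub_mem hf
  have hφD : ∀ f α, coeff α (φ (D f)) = (wt w α : K) * coeff α (φ f) :=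
    hDw.coeff_intertwiner_map
  have hmul := map_mul_of_intertwines D hDw φ hφ hφD
  have hbij := bijective_of_sub_mem φ hφ
  have hone : φ 1 = 1 := by
    obtain ⟨u, hu⟩ := hbij.2 1
    simpa [hu] using (hmul 1 u).symm
  exact ⟨AlgEquiv.ofBijective (AlgHom.ofLinearMap φ hone hmul) hbij, hφD⟩
end

section
/- Let K be a field of characteristic zero, R = MvPowerSeries (Fin n) K, and let D be a time-dependent formal vector field on K^n, i.e. a K-linear derivation of PowerSeries R with D(t) = 0. Then there exists a unique formal isotopy φ (a K-algebra automorphism of PowerSeries R with φ(t) = t) satisfying both the initial condition (IC): coeff_0(φ(C f)) = f for all f ∈ R, and the flow property (FP) for D: ∂/∂t(φ(C f)) = φ(D(C f)) for all f ∈ R. -/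
namespace FormalFlow

open PowerSeries Finset

variable {K R : Type*} [Field K] [CommRing R] [Algebra K R]

/-- The `k`-th Taylor coefficient in `t` of the flow of a derivation `R → R⟦X⟧` with
coefficients `δ`. -/
noncomputable def flowCoeff (δ : ℕ → R →ₗ[K] R) : ℕ → R →ₗ[K] R
  | 0 => LinearMap.id
  | k + 1 => ((k : K) + 1)⁻¹ • ∑ i : Fin (k + 1), flowCoeff δ i ∘ₗ δ (k - i)

theorem flowCoeff_zero (δ : ℕ → R →ₗ[K] R) : flowCoeff δ 0 = LinearMap.id := by
  rw [flowCoeff]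

theorem flowCoeff_succ_mul [CharZero K] (δ : ℕ → R →ₗ[K] R) (k : ℕ) (f : R) :
    flowCoeff δ (k + 1) f * (k + 1) =
      ∑ p ∈ antidiagonal k, flowCoeff δ p.1 (δ p.2 f) := by
  have hk : (k : K) + 1 ≠ 0 := by exact_mod_cast k.succ_ne_zero
  have hcast : (k : R) + 1 = algebraMap K R (k + 1) := by simp
  rw [flowCoeff, hcast, ← Algebra.commutes, ← Algebra.smul_def, LinearMap.smul_apply,
    smul_inv_smul₀ hk, Nat.sum_antidiagonal_eq_sum_range_succ_mk,
    Finset.sum_range fun i => flowCoeff δ i (δ (k - i) f)]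
  simp

/-- The `X`-adically continuous, `X`-linear extension to `R⟦X⟧` of the map
`f ↦ ∑ k, φ k f * X ^ k`. -/
noncomputable def extend (φ : ℕ → R →ₗ[K] R) : R⟦X⟧ →ₗ[K] R⟦X⟧ where
  toFun g := mk fun n => ∑ p ∈ antidiagonal n, φ p.1 (coeff p.2 g)
  map_add' g h := by ext; simp [sum_add_distrib]
  map_smul' c g := by
    ext n
    simp [smul_sum]

theorem coeff_extend (φ : ℕ → R →ₗ[K] R) (g : R⟦X⟧) (n : ℕ) :
    coeff n (extend φ g) = ∑ p ∈ antidiagonal n, φ p.1 (coeff p.2 g) := by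
  simp [extend, PowerSeries.coeff_mk]

theorem coeff_extend_C (φ : ℕ → R →ₗ[K] R) (f : R) (n : ℕ) :
    coeff n (extend φ (C f)) = φ n f := by
  rw [coeff_extend, sum_eq_single (n, 0)]
  · simp
  · rintro ⟨i, j⟩ hij hne
    have hj : j ≠ 0 := by
      rintro rfl
      simp_all
    simp [coeff_C, hj]
  · simp

theorem extend_X_mul (φ : ℕ → R →ₗ[K] R) (g : R⟦X⟧) :
    extend φ (X * g) = X * extend φ g := by
  ext n
  cases n with
  | zero => simp [coeff_extend]
  | succ n =>
    rw [coeff_succ_X_mul, coeff_extend, Nat.antidiagonal_succ', sum_cons, coeff_extend]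
    simp [coeff_succ_X_mul]

/-- Every power series splits into its constant coefficient and a multiple of `X`. -/
theorem exists_eq_C_add_X_mul (g : R⟦X⟧) : ∃ (a : R) (g' : R⟦X⟧), g = C a + X * g' :=
  ⟨_, _, (eq_X_mul_shift_add_const g).trans (add_comm _ _)⟩

theorem extend_bijective {φ : ℕ → R →ₗ[K] R} (h₀ : φ 0 = LinearMap.id) :
    Function.Bijective (extend φ) := by
  have coeff_eq (g : R⟦X⟧) (n : ℕ) : coeff n (extend φ g) =
      coeff n g + ∑ i : Fin n, φ (n - i) (coeff i g) := by
    rw [coeff_extend, ← Nat.sum_antidiagonal_swap,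
      Nat.sum_antidiagonal_eq_sum_range_succ_mk, sum_range_succ, Finset.sum_range]
    simp [h₀, add_comm]
  constructor
  · rw [injective_iff_map_eq_zero]
    intro g hg
    ext n
    induction n using Nat.strong_induction_on with
    | _ n ih =>
      have h := coeff_eq g n
      rw [hg, sum_eq_zero fun i _ => by rw [ih i i.2]; simp] at h
      simpa using h.symm
  · intro g
    let f : ℕ → R := Nat.strongRec fun n f => coeff n g - ∑ i : Fin n, φ (n - i) (f i i.2)
    refine ⟨mk f, ?_⟩
    ext n
    have hf : f n = coeff n g - ∑ i : Fin n, φ (n - i) (f i) := Nat.strongRec_eq _ _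
    simp [coeff_eq, PowerSeries.coeff_mk, hf]

/-- A ring endomorphism of `R⟦X⟧` fixing `X` is `X`-adically continuous, hence given by the
coefficients of the images of constants. -/
theorem coeff_map_of_map_X {φ : R⟦X⟧ →+* R⟦X⟧} (hX : φ X = X) (g : R⟦X⟧) (n : ℕ) :
    coeff n (φ g) = ∑ p ∈ antidiagonal n, coeff p.1 (φ (C (coeff p.2 g))) := by
  induction n generalizing g with
  | zero =>
    obtain ⟨a, g, rfl⟩ := exists_eq_C_add_X_mul g
    simp [hX]
  | succ n ih =>
    obtain ⟨a, g, rfl⟩ := exists_eq_C_add_X_mul g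
    rw [map_add, map_mul, hX, map_add, coeff_succ_X_mul, Nat.antidiagonal_succ', sum_cons, ih]
    simp [coeff_succ_X_mul, coeff_C]

theorem eq_of_mul_cast_succ_eq (K : Type*) [Field K] [Algebra K R] [CharZero K] {n : ℕ} {a b : R}
    (h : a * (n + 1) = b * (n + 1)) : a = b := by
  have hu : IsUnit ((n : R) + 1) := by
    have : IsUnit ((n : K) + 1) := .mk0 _ (by exact_mod_cast n.succ_ne_zero)
    simpa using this.map (algebraMap K R)
  exact hu.mul_right_cancel h

/-- The flow of a `K`-linear map `δ : R → R⟦X⟧`, as a `K`-linear endomorphism of `R⟦X⟧`. -/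
noncomputable def flow (δ : R →ₗ[K] R⟦X⟧) : R⟦X⟧ →ₗ[K] R⟦X⟧ :=
  extend <| flowCoeff fun n => ((coeff n).restrictScalars K : R⟦X⟧ →ₗ[K] R) ∘ₗ δ

theorem flow_X_mul (δ : R →ₗ[K] R⟦X⟧) (g : R⟦X⟧) : flow δ (X * g) = X * flow δ g :=
  extend_X_mul _ _

theorem flow_bijective (δ : R →ₗ[K] R⟦X⟧) : Function.Bijective (flow δ) :=
  extend_bijective (flowCoeff_zero _)

theorem coeff_zero_flow (δ : R →ₗ[K] R⟦X⟧) (g : R⟦X⟧) : coeff 0 (flow δ g) = coeff 0 g := by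
  simp [flow, coeff_extend, flowCoeff_zero]

theorem derivative_flow_C [CharZero K] (δ : R →ₗ[K] R⟦X⟧) (f : R) :
    derivative R (flow δ (C f)) = flow δ (δ f) := by
  ext n
  rw [coeff_derivative, flow, coeff_extend_C, flowCoeff_succ_mul, coeff_extend]
  rfl

theorem flow_mul [CharZero K] {δ : R →ₗ[K] R⟦X⟧}
    (hδ : ∀ a b, δ (a * b) = C a * δ b + C b * δ a) (g h : R⟦X⟧) :
    flow δ (g * h) = flow δ g * flow δ h := by
  ext n
  induction n generalizing g h with
  | zero => simp only [coeff_mul, Nat.antidiagonal_zero, sum_singleton, coeff_zero_flow]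
  | succ n ih =>
    obtain ⟨a, g, rfl⟩ := exists_eq_C_add_X_mul g
    obtain ⟨b, h, rfl⟩ := exists_eq_C_add_X_mul h
    have hC : coeff (n + 1) (flow δ (C (a * b))) =
        coeff (n + 1) (flow δ (C a) * flow δ (C b)) := by
      apply eq_of_mul_cast_succ_eq K (n := n)
      rw [← coeff_derivative, ← coeff_derivative, derivative_flow_C, Derivation.leibniz,
        derivative_flow_C, derivative_flow_C, hδ, map_add, map_add, map_add, ih, ih,
        smul_eq_mul, smul_eq_mul]
    have hl : (C a + X * g) * (C b + X * h) =
        C (a * b) + (X * (g * (C b + X * h)) + X * (C a * h)) := by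
      rw [map_mul]; ring
    have hr : (flow δ (C a) + X * flow δ g) * (flow δ (C b) + X * flow δ h) =
        flow δ (C a) * flow δ (C b) +
          (X * (flow δ g * flow δ (C b + X * h)) + X * (flow δ (C a) * flow δ h)) := by
      rw [map_add, flow_X_mul]; ring
    rw [hl, map_add (flow δ) (C a), map_add (flow δ) (C b) (X * h), flow_X_mul, flow_X_mul, hr]
    simp only [map_add (flow δ) (C (a * b)), map_add (flow δ) (X * _) (X * (C a * h)),
      map_add (coeff (n + 1)), flow_X_mul δ (g * _), flow_X_mul δ (C a * h),
      coeff_succ_X_mul, hC, ih]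

theorem flow_one [CharZero K] {δ : R →ₗ[K] R⟦X⟧}
    (hδ : ∀ a b, δ (a * b) = C a * δ b + C b * δ a) : flow δ 1 = 1 := by
  obtain ⟨g, hg⟩ := (flow_bijective δ).2 1
  simpa [hg] using (flow_mul hδ 1 g).symm

/-- The flow of a derivation `δ : R → R⟦X⟧`, as a `K`-algebra automorphism of `R⟦X⟧`. -/
noncomputable def flowEquiv [CharZero K] (δ : R →ₗ[K] R⟦X⟧)
    (hδ : ∀ a b, δ (a * b) = C a * δ b + C b * δ a) : R⟦X⟧ ≃ₐ[K] R⟦X⟧ :=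
  AlgEquiv.ofBijective (AlgHom.ofLinearMap (flow δ) (flow_one hδ) (flow_mul hδ))
    (flow_bijective δ)

theorem flowEquiv_apply [CharZero K] (δ : R →ₗ[K] R⟦X⟧)
    (hδ : ∀ a b, δ (a * b) = C a * δ b + C b * δ a) (g : R⟦X⟧) :
    flowEquiv δ hδ g = flow δ g :=
  rfl

theorem flowEquiv_X [CharZero K] (δ : R →ₗ[K] R⟦X⟧)
    (hδ : ∀ a b, δ (a * b) = C a * δ b + C b * δ a) : flowEquiv δ hδ X = X := by
  rw [flowEquiv_apply, ← mul_one X, flow_X_mul, flow_one hδ]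

/-- A ring endomorphism of `R⟦X⟧` fixing `X` is determined by the initial condition and the flow
property. -/
theorem eq_of_flow_property (K : Type*) [Field K] [CharZero K] [Algebra K R] {δ : R → R⟦X⟧}
    {φ ψ : R⟦X⟧ →+* R⟦X⟧} (hφ : φ X = X) (hψ : ψ X = X)
    (hφ₀ : ∀ f, coeff 0 (φ (C f)) = f) (hψ₀ : ∀ f, coeff 0 (ψ (C f)) = f)
    (hφδ : ∀ f, derivative R (φ (C f)) = φ (δ f))
    (hψδ : ∀ f, derivative R (ψ (C f)) = ψ (δ f)) : φ = ψ := by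
  have hC (n : ℕ) : ∀ f, coeff n (φ (C f)) = coeff n (ψ (C f)) := by
    induction n using Nat.strong_induction_on with
    | _ n ih =>
      intro f
      cases n with
      | zero => rw [hφ₀, hψ₀]
      | succ n =>
        apply eq_of_mul_cast_succ_eq K (n := n)
        rw [← coeff_derivative, ← coeff_derivative, hφδ, hψδ, coeff_map_of_map_X hφ,
          coeff_map_of_map_X hψ]
        exact sum_congr rfl fun p hp =>
          ih p.1 (Nat.lt_succ_of_le (Nat.le.intro (mem_antidiagonal.1 hp))) _
  ext g n
  rw [coeff_map_of_map_X hφ, coeff_map_of_map_X hψ]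
  exact sum_congr rfl fun p _ => hC _ _

end FormalFlow

/-- **Existence and uniqueness of flows of time-dependent formal vector fields.**
Let `K` be a field of characteristic zero and `R = MvPowerSeries (Fin n) K`.
For every time-dependent formal vector field `D` (a `K`-linear derivation of
`PowerSeries R` with `D t = 0`) there exists a unique formal isotopy `φ`
(a `K`-algebra automorphism of `PowerSeries R` fixing `t`) satisfying the initial
condition `coeff 0 (φ (C f)) = f` and the flow property
`∂/∂t (φ (C f)) = φ (D (C f))` for all `f ∈ R`. -/
theorem flow_existence_uniqueness
    (K : Type*) [Field K] [CharZero K] (n : ℕ)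
    (D : Derivation K (PowerSeries (MvPowerSeries (Fin n) K))
          (PowerSeries (MvPowerSeries (Fin n) K)))
    (hD : D PowerSeries.X = 0) :
    ∃! φ : PowerSeries (MvPowerSeries (Fin n) K) ≃ₐ[K]
            PowerSeries (MvPowerSeries (Fin n) K),
      φ PowerSeries.X = PowerSeries.X ∧
      (∀ f : MvPowerSeries (Fin n) K,
        PowerSeries.coeff (R := MvPowerSeries (Fin n) K) 0
          (φ (PowerSeries.C (R := MvPowerSeries (Fin n) K) f)) = f) ∧
      (∀ f : MvPowerSeries (Fin n) K,
        PowerSeries.derivative (MvPowerSeries (Fin n) K)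
            (φ (PowerSeries.C (R := MvPowerSeries (Fin n) K) f)) =
          φ (D (PowerSeries.C (R := MvPowerSeries (Fin n) K) f))) := by
  let δ : MvPowerSeries (Fin n) K →ₗ[K] PowerSeries (MvPowerSeries (Fin n) K) :=
    D.toLinearMap ∘ₗ (IsScalarTower.toAlgHom K (MvPowerSeries (Fin n) K)
      (PowerSeries (MvPowerSeries (Fin n) K))).toLinearMap
  have hδ_apply (f : MvPowerSeries (Fin n) K) : δ f = D (PowerSeries.C f) := rfl
  have hδ (a b : MvPowerSeries (Fin n) K) :
      δ (a * b) = PowerSeries.C a * δ b + PowerSeries.C b * δ a := by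
    simp only [hδ_apply, map_mul, D.leibniz, smul_eq_mul]
  have hX := FormalFlow.flowEquiv_X δ hδ
  have h₀ (f : MvPowerSeries (Fin n) K) :
      PowerSeries.coeff 0 (FormalFlow.flowEquiv δ hδ (PowerSeries.C f)) = f := by
    rw [FormalFlow.flowEquiv_apply, FormalFlow.coeff_zero_flow, PowerSeries.coeff_zero_C]
  have hflow (f : MvPowerSeries (Fin n) K) :
      PowerSeries.derivative _ (FormalFlow.flowEquiv δ hδ (PowerSeries.C f)) =
        FormalFlow.flowEquiv δ hδ (D (PowerSeries.C f)) :=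
    FormalFlow.derivative_flow_C δ f
  refine ⟨FormalFlow.flowEquiv δ hδ, ⟨hX, h₀, hflow⟩, ?_⟩
  rintro ψ ⟨hψX, hψ₀, hψflow⟩
  have h := FormalFlow.eq_of_flow_property K (δ := δ) (φ := RingHomClass.toRingHom ψ)
    (ψ := RingHomClass.toRingHom (FormalFlow.flowEquiv δ hδ)) hψX hX hψ₀ h₀ hψflow hflow
  exact AlgEquiv.ext fun g => RingHom.congr_fun h g
end

section
/- Let K be a field of characteristic zero and R = MvPowerSeries (Fin n) K. For a K-algebra endomorphism φ of PowerSeries R with φ(t) = t, define its time-zero slice φ₀ : R → R by φ₀(f) = coeff_0(φ(C f)). Then: (1) for any two K-algebra endomorphisms φ, ψ of PowerSeries R fixing t, (ψ∘φ)₀ = ψ₀∘φ₀, i.e. coeff_0(ψ(φ(C f))) = coeff_0(ψ(C(coeff_0(φ(C f))))) for all f ∈ R; (2) if φ is a formal isotopy (a K-algebra automorphism fixing t), then φ₀ is a K-algebra automorphism of R with inverse (φ⁻¹)₀. -/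
namespace PowerSeries

variable {K R : Type*} [CommSemiring K] [CommSemiring R] [Algebra K R]

/-- The value at `t = 0` of an endomorphism fixing `t` depends only on the value of its
argument at `t = 0`. -/
theorem coeff_zero_map_eq_coeff_zero_map_C (ψ : PowerSeries R →ₐ[K] PowerSeries R)
    (hψ : ψ X = X) (g : PowerSeries R) :
    coeff 0 (ψ g) = coeff 0 (ψ (C (coeff 0 g))) := by
  conv_lhs => rw [eq_X_mul_shift_add_const g]
  simp [hψ]

/-- The time-zero slice `f ↦ coeff 0 (φ (C f))` of an endomorphism of `PowerSeries R`, as an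
algebra homomorphism. -/
noncomputable def timeZeroSlice (φ : PowerSeries R →ₐ[K] PowerSeries R) : R →ₐ[K] R where
  toRingHom := (constantCoeff (R := R)).comp (φ.toRingHom.comp (C (R := R)))
  commutes' r := by
    change constantCoeff (φ (C (algebraMap K R r))) = algebraMap K R r
    rw [← algebraMap_apply, AlgHom.commutes, algebraMap_apply, constantCoeff_C]

theorem timeZeroSlice_apply (φ : PowerSeries R →ₐ[K] PowerSeries R) (f : R) :
    timeZeroSlice φ f = coeff 0 (φ (C f)) := by
  simp [timeZeroSlice]

theorem timeZeroSlice_comp (φ ψ : PowerSeries R →ₐ[K] PowerSeries R) (hψ : ψ X = X) :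
    timeZeroSlice (ψ.comp φ) = (timeZeroSlice ψ).comp (timeZeroSlice φ) := by
  ext f
  simpa [timeZeroSlice_apply] using coeff_zero_map_eq_coeff_zero_map_C ψ hψ (φ (C f))

theorem timeZeroSlice_id : timeZeroSlice (AlgHom.id K (PowerSeries R)) = AlgHom.id K R := by
  ext f
  simp [timeZeroSlice_apply]

/-- The time-zero slice of an automorphism of `PowerSeries R` fixing `t`, as an automorphism
of `R`. -/
noncomputable def timeZeroSliceEquiv (φ : PowerSeries R ≃ₐ[K] PowerSeries R) (hφ : φ X = X) : R ≃ₐ[K] R :=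
  AlgEquiv.ofAlgHom (timeZeroSlice φ.toAlgHom) (timeZeroSlice φ.symm.toAlgHom)
    (by rw [← timeZeroSlice_comp _ φ.toAlgHom hφ]; simp [timeZeroSlice_id])
    (by
      have h : φ.symm X = X := by rw [AlgEquiv.symm_apply_eq, hφ]
      rw [← timeZeroSlice_comp _ φ.symm.toAlgHom h]; simp [timeZeroSlice_id])

end PowerSeries

/-- **Time-zero slices are compatible with composition and inversion.**
Let `K` be a field of characteristic zero and `R = MvPowerSeries (Fin n) K`.  For a
`K`-algebra endomorphism `φ` of `PowerSeries R` fixing `t`, its time-zero slice is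
`φ₀ f = coeff 0 (φ (C f))`.  Then `(ψ ∘ φ)₀ = ψ₀ ∘ φ₀` for any two such endomorphisms,
and if `φ` is a formal isotopy then `φ₀` is a `K`-algebra automorphism of `R` with
inverse `(φ⁻¹)₀`. -/
theorem time_zero_slice_composition
    (K : Type*) [Field K] [CharZero K] (n : ℕ) :
    (∀ φ ψ : PowerSeries (MvPowerSeries (Fin n) K) →ₐ[K]
              PowerSeries (MvPowerSeries (Fin n) K),
      φ PowerSeries.X = PowerSeries.X → ψ PowerSeries.X = PowerSeries.X →
      ∀ f : MvPowerSeries (Fin n) K,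
        PowerSeries.coeff (R := MvPowerSeries (Fin n) K) 0
            (ψ (φ (PowerSeries.C (R := MvPowerSeries (Fin n) K) f))) =
          PowerSeries.coeff (R := MvPowerSeries (Fin n) K) 0
            (ψ (PowerSeries.C (R := MvPowerSeries (Fin n) K)
              (PowerSeries.coeff (R := MvPowerSeries (Fin n) K) 0
                (φ (PowerSeries.C (R := MvPowerSeries (Fin n) K) f)))))) ∧
    (∀ φ : PowerSeries (MvPowerSeries (Fin n) K) ≃ₐ[K]
            PowerSeries (MvPowerSeries (Fin n) K),
      φ PowerSeries.X = PowerSeries.X →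
      ∃ e : MvPowerSeries (Fin n) K ≃ₐ[K] MvPowerSeries (Fin n) K,
        (∀ f : MvPowerSeries (Fin n) K,
          e f = PowerSeries.coeff (R := MvPowerSeries (Fin n) K) 0
            (φ (PowerSeries.C (R := MvPowerSeries (Fin n) K) f))) ∧
        (∀ f : MvPowerSeries (Fin n) K,
          e.symm f = PowerSeries.coeff (R := MvPowerSeries (Fin n) K) 0
            (φ.symm (PowerSeries.C (R := MvPowerSeries (Fin n) K) f)))) := by
  refine ⟨fun φ ψ _ hψ f => PowerSeries.coeff_zero_map_eq_coeff_zero_map_C ψ hψ _,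
    fun φ hφ => ⟨PowerSeries.timeZeroSliceEquiv φ hφ,
      PowerSeries.timeZeroSlice_apply φ.toAlgHom,
      PowerSeries.timeZeroSlice_apply φ.symm.toAlgHom⟩⟩
end

section
/- Let K be a field of characteristic zero, R = MvPowerSeries (Fin n) K, D a time-dependent formal vector field (a K-linear derivation of PowerSeries R with D(t) = 0), and φ a formal isotopy (K-algebra automorphism of PowerSeries R with φ(t) = t) satisfying the flow property (FP) for D: ∂/∂t(φ(C f)) = φ(D(C f)) for all f ∈ R. Then the flow property extends to all time-dependent elements: for every g ∈ PowerSeries R, ∂/∂t(φ(g)) = φ(∂/∂t(g) + D(g)); equivalently, ∂/∂t ∘ φ = φ ∘ (∂/∂t + D) as maps PowerSeries R → PowerSeries R. -/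
/-- An additive endomorphism of `S⟦X⟧` that vanishes on constants and commutes with multiplication
by `X` is zero: its values are divisible by every power of `X`. -/
theorem PowerSeries.addMonoidHom_eq_zero_of_X_mul {S : Type*} [CommRing S]
    (E : PowerSeries S →+ PowerSeries S) (hC : ∀ a, E (PowerSeries.C a) = 0)
    (hX : ∀ g, E (PowerSeries.X * g) = PowerSeries.X * E g) : E = 0 := by
  have dvd (k : ℕ) : ∀ g, (PowerSeries.X : PowerSeries S) ^ k ∣ E g := by
    induction k with
    | zero => simp
    | succ k ih =>
      intro g
      rw [PowerSeries.eq_X_mul_shift_add_const g, map_add, hC, hX, add_zero, pow_succ']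
      exact mul_dvd_mul_left _ (ih _)
  ext g k
  simpa using PowerSeries.X_pow_dvd_iff.mp (dvd (k + 1) g) k k.lt_succ_self


/-- **The flow property extends from time-independent to all time-dependent elements.**
Let `K` be a field of characteristic zero, `R = MvPowerSeries (Fin n) K`, `D` a
time-dependent formal vector field (`K`-linear derivation of `PowerSeries R` with
`D t = 0`), and `φ` a formal isotopy satisfying the flow property
`∂/∂t (φ (C f)) = φ (D (C f))` for all `f ∈ R`.  Then for every `g ∈ PowerSeries R`,
`∂/∂t (φ g) = φ (∂/∂t g + D g)`; equivalently `∂/∂t ∘ φ = φ ∘ (∂/∂t + D)`. -/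
theorem flow_property_extends
    (K : Type*) [Field K] [CharZero K] (n : ℕ)
    (D : Derivation K (PowerSeries (MvPowerSeries (Fin n) K))
          (PowerSeries (MvPowerSeries (Fin n) K)))
    (hD : D PowerSeries.X = 0)
    (φ : PowerSeries (MvPowerSeries (Fin n) K) ≃ₐ[K]
          PowerSeries (MvPowerSeries (Fin n) K))
    (hφX : φ PowerSeries.X = PowerSeries.X)
    (hFP : ∀ f : MvPowerSeries (Fin n) K,
      PowerSeries.derivative (MvPowerSeries (Fin n) K)
          (φ (PowerSeries.C (R := MvPowerSeries (Fin n) K) f)) =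
        φ (D (PowerSeries.C (R := MvPowerSeries (Fin n) K) f))) :
    ∀ g : PowerSeries (MvPowerSeries (Fin n) K),
      PowerSeries.derivative (MvPowerSeries (Fin n) K) (φ g) =
        φ (PowerSeries.derivative (MvPowerSeries (Fin n) K) g + D g) := by
  let S := MvPowerSeries (Fin n) K
  let d : PowerSeries S →+ PowerSeries S := (PowerSeries.derivative S : _ →ₗ[S] _).toAddMonoidHom
  let p : PowerSeries S →+ PowerSeries S := (φ : _ →+* _).toAddMonoidHom
  let v : PowerSeries S →+ PowerSeries S := (D : _ →ₗ[K] _).toAddMonoidHom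
  let E := d.comp p - p.comp (d + v)
  have hE (g) : E g = PowerSeries.derivative S (φ g) - φ (PowerSeries.derivative S g + D g) := rfl
  have E_eq_zero : E = 0 := by
    apply PowerSeries.addMonoidHom_eq_zero_of_X_mul
    · intro a
      rw [hE, hFP, PowerSeries.derivative_C, zero_add, sub_self]
    · intro g
      simp only [hE, map_mul, map_add, hφX, Derivation.leibniz, smul_eq_mul,
        PowerSeries.derivative_X, hD, mul_zero, mul_one, add_zero]
      ring
  exact fun g => sub_eq_zero.mp (DFunLike.congr_fun E_eq_zero g)
end

section
/- Let K be a field of characteristic zero, R = MvPowerSeries (Fin n) K, D a time-dependent formal vector field, and φ a formal isotopy satisfying the flow property (FP) for D. Then for every time-dependent formal vector field Y (a K-linear derivation of PowerSeries R with Y(t) = 0), the pullback φ*Y := φ∘Y∘φ⁻¹ satisfies d/dt(φ*Y) = φ*(dY/dt + [D,Y]); explicitly, as maps PowerSeries R → PowerSeries R, ∂/∂t ∘ (φ∘Y∘φ⁻¹) − (φ∘Y∘φ⁻¹) ∘ ∂/∂t = φ ∘ (∂/∂t∘Y − Y∘∂/∂t + D∘Y − Y∘D) ∘ φ⁻¹.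 -/
/-- An additive endomorphism of `R⟦X⟧` which kills the constants and commutes with multiplication
by `X` vanishes, because all of its values are divisible by every power of `X`. -/
theorem PowerSeries.addMonoidHom_eq_zero_of_C_of_X_mul {R : Type*} [CommRing R]
    (δ : PowerSeries R →+ PowerSeries R) (hC : ∀ r : R, δ (PowerSeries.C r) = 0)
    (hX : ∀ f, δ (PowerSeries.X * f) = PowerSeries.X * δ f) : δ = 0 := by
  have coeff_eq_zero : ∀ (m : ℕ) (f : PowerSeries R), PowerSeries.coeff m (δ f) = 0 := by
    intro m
    induction m with
    | zero =>
      intro f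
      rw [PowerSeries.eq_X_mul_shift_add_const f, map_add, hC, add_zero, hX,
        PowerSeries.coeff_zero_X_mul]
    | succ m ih =>
      intro f
      rw [PowerSeries.eq_X_mul_shift_add_const f, map_add, hC, add_zero, hX,
        PowerSeries.coeff_succ_X_mul, ih]
  ext f m
  simpa using coeff_eq_zero m f

/-- The flow property for constants extends to all time-dependent functions: if an automorphism `φ`
of `R⟦X⟧` fixes `X`, `D X = 0` and `∂ (φ f) = φ (D f)` for constant `f`, then
`∂ (φ f) = φ (∂ f + D f)` for all `f`. -/
theorem PowerSeries.derivative_algEquiv_apply_of_flow {K R : Type*} [CommRing K] [CommRing R]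
    [Algebra K R] (D : Derivation K (PowerSeries R) (PowerSeries R))
    (hD : D PowerSeries.X = 0) (φ : PowerSeries R ≃ₐ[K] PowerSeries R)
    (hφX : φ PowerSeries.X = PowerSeries.X)
    (hFP : ∀ r : R, PowerSeries.derivative R (φ (PowerSeries.C r)) = φ (D (PowerSeries.C r)))
    (f : PowerSeries R) :
    PowerSeries.derivative R (φ f) = φ (PowerSeries.derivative R f + D f) := by
  let δ : PowerSeries R →+ PowerSeries R :=
    { toFun := fun f => PowerSeries.derivative R (φ f) - φ (PowerSeries.derivative R f + D f)
      map_zero' := by simp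
      map_add' := fun f g => by simp only [map_add]; ring }
  have hδ : δ = 0 := by
    refine PowerSeries.addMonoidHom_eq_zero_of_C_of_X_mul δ (fun r => ?_) (fun f => ?_)
    · change PowerSeries.derivative R (φ (PowerSeries.C r)) -
        φ (PowerSeries.derivative R (PowerSeries.C r) + D (PowerSeries.C r)) = 0
      rw [hFP, PowerSeries.derivative_C, zero_add, sub_self]
    · change PowerSeries.derivative R (φ (PowerSeries.X * f)) -
        φ (PowerSeries.derivative R (PowerSeries.X * f) + D (PowerSeries.X * f)) =
        PowerSeries.X * (PowerSeries.derivative R (φ f) - φ (PowerSeries.derivative R f + D f))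
      simp only [map_mul, map_add, hφX, Derivation.leibniz, hD, smul_eq_mul,
        PowerSeries.derivative_X, mul_one, mul_zero, add_zero]
      ring
  exact sub_eq_zero.mp (DFunLike.congr_fun hδ f)

/-- **Flow property for pullbacks of time-dependent formal vector fields.**
Let `K` be a field of characteristic zero, `R = MvPowerSeries (Fin n) K`, `D` a
time-dependent formal vector field, and `φ` a formal isotopy satisfying the flow
property for `D`.  For every time-dependent formal vector field `Y`, the pullback
`φ*Y := φ ∘ Y ∘ φ⁻¹` satisfies `d/dt (φ*Y) = φ*(dY/dt + [D,Y])`, written out as an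
identity of maps `PowerSeries R → PowerSeries R` applied to each `g`. -/
theorem pullback_flow_property
    (K : Type*) [Field K] [CharZero K] (n : ℕ)
    (D : Derivation K (PowerSeries (MvPowerSeries (Fin n) K))
          (PowerSeries (MvPowerSeries (Fin n) K)))
    (hD : D PowerSeries.X = 0)
    (φ : PowerSeries (MvPowerSeries (Fin n) K) ≃ₐ[K]
          PowerSeries (MvPowerSeries (Fin n) K))
    (hφX : φ PowerSeries.X = PowerSeries.X)
    (hFP : ∀ f : MvPowerSeries (Fin n) K,
      PowerSeries.derivative (MvPowerSeries (Fin n) K)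
          (φ (PowerSeries.C (R := MvPowerSeries (Fin n) K) f)) =
        φ (D (PowerSeries.C (R := MvPowerSeries (Fin n) K) f)))
    (Y : Derivation K (PowerSeries (MvPowerSeries (Fin n) K))
          (PowerSeries (MvPowerSeries (Fin n) K)))
    (hY : Y PowerSeries.X = 0) :
    ∀ g : PowerSeries (MvPowerSeries (Fin n) K),
      PowerSeries.derivative (MvPowerSeries (Fin n) K) (φ (Y (φ.symm g))) -
          φ (Y (φ.symm (PowerSeries.derivative (MvPowerSeries (Fin n) K) g))) =
        φ (PowerSeries.derivative (MvPowerSeries (Fin n) K) (Y (φ.symm g)) -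
            Y (PowerSeries.derivative (MvPowerSeries (Fin n) K) (φ.symm g)) +
            (D (Y (φ.symm g)) - Y (D (φ.symm g)))) := by
  intro g
  have flow := PowerSeries.derivative_algEquiv_apply_of_flow D hD φ hφX hFP
  have symm_derivative : φ.symm (PowerSeries.derivative (MvPowerSeries (Fin n) K) g) =
      PowerSeries.derivative (MvPowerSeries (Fin n) K) (φ.symm g) + D (φ.symm g) := by
    rw [AlgEquiv.symm_apply_eq, ← flow, AlgEquiv.apply_symm_apply]
  rw [symm_derivative, flow, ← map_sub, map_add Y]
  congr 1
  abel
end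

section
/- Let K be a field of characteristic zero, R = MvPowerSeries (Fin n) K, D a time-dependent formal vector field, and φ the flow of D, i.e. a formal isotopy satisfying the initial condition (IC) and the flow property (FP) for D. Then the inverse isotopy φ⁻¹ also satisfies (IC), and φ⁻¹ is the flow of −φ∘D∘φ⁻¹: for every f ∈ R, ∂/∂t(φ⁻¹(C f)) = φ⁻¹((−φ∘D∘φ⁻¹)(C f)), equivalently ∂/∂t(φ⁻¹(C f)) = −D(φ⁻¹(C f)). -/
/-- Every power series is its constant term plus a multiple of the variable. -/
theorem PowerSeries.exists_eq_C_coeff_zero_add_X_mul {R : Type*} [CommRing R]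
    (F : PowerSeries R) :
    ∃ G, F = PowerSeries.C (PowerSeries.coeff 0 F) + PowerSeries.X * G := by
  have h : PowerSeries.X ∣ F - PowerSeries.C (PowerSeries.coeff 0 F) := by
    simp [PowerSeries.X_dvd_iff]
  obtain ⟨G, hG⟩ := h
  exact ⟨G, by rw [← hG]; ring⟩

/-- An additive endomorphism of `R⟦X⟧` that vanishes on constants and commutes with
multiplication by `X` is zero. -/
theorem PowerSeries.eq_zero_of_map_C_of_map_X_mul {R : Type*} [CommRing R]
    (E : PowerSeries R → PowerSeries R) (hadd : ∀ F G, E (F + G) = E F + E G)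
    (hC : ∀ f, E (PowerSeries.C f) = 0)
    (hX : ∀ F, E (PowerSeries.X * F) = PowerSeries.X * E F) (F : PowerSeries R) :
    E F = 0 := by
  have hdvd (m : ℕ) : ∀ F, PowerSeries.X ^ m ∣ E F := by
    induction m with
    | zero => simp
    | succ m ih =>
      intro F
      obtain ⟨G, hG⟩ := F.exists_eq_C_coeff_zero_add_X_mul
      rw [hG, hadd, hC, hX, zero_add, pow_succ']
      exact mul_dvd_mul_left _ (ih G)
  ext m
  simpa using PowerSeries.X_pow_dvd_iff.mp (hdvd (m + 1) F) m m.lt_succ_self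

/-- The flow property on constants extends to all time-dependent power series, where it picks
up the formal time derivative of the argument. -/
theorem PowerSeries.derivative_flow {K R : Type*} [CommRing K] [CommRing R] [Algebra K R]
    (D : Derivation K (PowerSeries R) (PowerSeries R)) (hD : D PowerSeries.X = 0)
    (φ : PowerSeries R ≃ₐ[K] PowerSeries R) (hφX : φ PowerSeries.X = PowerSeries.X)
    (hFP : ∀ f : R, PowerSeries.derivative R (φ (PowerSeries.C f)) = φ (D (PowerSeries.C f)))
    (F : PowerSeries R) :
    PowerSeries.derivative R (φ F) = φ (D F + PowerSeries.derivative R F) := by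
  rw [← sub_eq_zero]
  refine eq_zero_of_map_C_of_map_X_mul
    (fun F => PowerSeries.derivative R (φ F) - φ (D F + PowerSeries.derivative R F))
    (fun F G => ?_) (fun f => ?_) (fun F => ?_) F
  · simp only [map_add]
    ring
  · simp [hFP]
  · simp only [map_mul, map_add, Derivation.leibniz, smul_eq_mul, hD, hφX,
      PowerSeries.derivative_X, mul_zero, mul_one, add_zero]
    ring

/-- **The inverse of a flow is the flow of the negated pullback.**
Let `K` be a field of characteristic zero, `R = MvPowerSeries (Fin n) K`, `D` a
time-dependent formal vector field, and `φ` its flow (a formal isotopy satisfying the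
initial condition and flow property for `D`).  Then `φ⁻¹` also satisfies the initial
condition, and `φ⁻¹` is the flow of `-φ ∘ D ∘ φ⁻¹`: for all `f ∈ R`,
`∂/∂t (φ⁻¹ (C f)) = φ⁻¹ ((-φ ∘ D ∘ φ⁻¹) (C f))`, equivalently
`∂/∂t (φ⁻¹ (C f)) = -D (φ⁻¹ (C f))`. -/
theorem inverse_flow
    (K : Type*) [Field K] [CharZero K] (n : ℕ)
    (D : Derivation K (PowerSeries (MvPowerSeries (Fin n) K))
          (PowerSeries (MvPowerSeries (Fin n) K)))
    (hD : D PowerSeries.X = 0)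
    (φ : PowerSeries (MvPowerSeries (Fin n) K) ≃ₐ[K]
          PowerSeries (MvPowerSeries (Fin n) K))
    (hφX : φ PowerSeries.X = PowerSeries.X)
    (hIC : ∀ f : MvPowerSeries (Fin n) K,
      PowerSeries.coeff (R := MvPowerSeries (Fin n) K) 0
        (φ (PowerSeries.C (R := MvPowerSeries (Fin n) K) f)) = f)
    (hFP : ∀ f : MvPowerSeries (Fin n) K,
      PowerSeries.derivative (MvPowerSeries (Fin n) K)
          (φ (PowerSeries.C (R := MvPowerSeries (Fin n) K) f)) =
        φ (D (PowerSeries.C (R := MvPowerSeries (Fin n) K) f))) :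
    (∀ f : MvPowerSeries (Fin n) K,
      PowerSeries.coeff (R := MvPowerSeries (Fin n) K) 0
        (φ.symm (PowerSeries.C (R := MvPowerSeries (Fin n) K) f)) = f) ∧
    (∀ f : MvPowerSeries (Fin n) K,
      PowerSeries.derivative (MvPowerSeries (Fin n) K)
          (φ.symm (PowerSeries.C (R := MvPowerSeries (Fin n) K) f)) =
        φ.symm (-(φ (D (φ.symm (PowerSeries.C (R := MvPowerSeries (Fin n) K) f)))))) ∧
    (∀ f : MvPowerSeries (Fin n) K,
      PowerSeries.derivative (MvPowerSeries (Fin n) K)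
          (φ.symm (PowerSeries.C (R := MvPowerSeries (Fin n) K) f)) =
        -(D (φ.symm (PowerSeries.C (R := MvPowerSeries (Fin n) K) f)))) := by
  have hinv (f : MvPowerSeries (Fin n) K) :
      PowerSeries.derivative (MvPowerSeries (Fin n) K) (φ.symm (PowerSeries.C f)) =
        -(D (φ.symm (PowerSeries.C f))) := by
    have h := PowerSeries.derivative_flow D hD φ hφX hFP (φ.symm (PowerSeries.C f))
    rw [φ.apply_symm_apply, PowerSeries.derivative_C, eq_comm,
      EmbeddingLike.map_eq_zero_iff] at h
    exact eq_neg_of_add_eq_zero_right h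
  refine ⟨fun f => ?_, fun f => ?_, hinv⟩
  · obtain ⟨G, hG⟩ := (φ.symm (PowerSeries.C f)).exists_eq_C_coeff_zero_add_X_mul
    have h := congrArg (fun F => PowerSeries.coeff 0 (φ F)) hG
    simp only [φ.apply_symm_apply, map_add, map_mul, hφX, hIC,
      PowerSeries.coeff_zero_X_mul, add_zero, PowerSeries.coeff_zero_C] at h
    exact h.symm
  · rw [map_neg, φ.symm_apply_apply, hinv]
end

section
/- Let K be a field of characteristic zero, R = MvPowerSeries (Fin n) K, w a weighting of K^n, and φ a formal isotopy (a K-algebra automorphism of PowerSeries R with φ(t) = t). Write φ^{k,i} := coeff_k(φ(C(x^i))) ∈ R for its components. Suppose: (1) for every i, coeff_α(φ^{0,i}) = 0 whenever ⟨w,α⟩ < w i; (2) for every k ≥ 1 and every i, coeff_α(φ^{k,i}) = 0 whenever ⟨w,α⟩ < w i + 1; (3) the orders tend to infinity: for every N ∈ ℕ there exists K₀ such that for all k ≥ K₀, all i, and all multi-indices α with |α| < N, coeff_α(φ^{k,i}) = 0. Then φ is evaluative: (a) for every i and every multi-index α, the set {k : coeff_α(φ^{k,i}) ≠ 0} is finite;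 (b) constantCoeff(φ^{k,i}) = 0 for all k and i; (c) the matrix p : Matrix (Fin n) (Fin n) (Polynomial K) with p i j := Σ_k coeff_{e_j}(φ^{k,i})·t^k (a polynomial by (a)) has determinant equal to a nonzero constant polynomial. -/
namespace MvPowerSeries

/-- A power series all of whose monomials involve a variable from `s` lies in the ideal
generated by these variables. -/
theorem mem_span_X_image {σ R : Type*} [CommRing R] (s : Finset σ) (f : MvPowerSeries σ R)
    (hf : ∀ α : σ →₀ ℕ, (∀ i ∈ s, α i = 0) → coeff α f = 0) :
    f ∈ Ideal.span ((X : σ → MvPowerSeries σ R) '' s) := by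
  classical
  induction s using Finset.induction_on generalizing f with
  | empty =>
    have : f = 0 := by
      ext α
      simpa using hf α (by simp)
    simp [this]
  | insert a s _ ih =>
    let g : MvPowerSeries σ R := fun α => if α a = 0 then coeff α f else 0
    have hg (α : σ →₀ ℕ) : coeff α g = if α a = 0 then coeff α f else 0 := rfl
    have hgs : g ∈ Ideal.span ((X : σ → MvPowerSeries σ R) '' s) := by
      refine ih g fun α hα => ?_
      rw [hg]
      split_ifs with h
      · exact hf α (by simpa [h] using hα)
      · rfl
    obtain ⟨h, hh⟩ : (X a : MvPowerSeries σ R) ∣ f - g :=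
      X_dvd_iff.mpr fun α hα => by simp [hg, hα]
    rw [← sub_add_cancel f g, hh]
    refine Ideal.add_mem _ (Ideal.mul_mem_right _ _ (Ideal.subset_span ⟨a, by simp, rfl⟩)) ?_
    exact Ideal.span_mono (Set.image_mono (by simp)) hgs

theorem exists_eq_sum_mul_X {σ R : Type*} [Fintype σ] [CommRing R] (f : MvPowerSeries σ R)
    (hf : constantCoeff f = 0) : ∃ c : σ → MvPowerSeries σ R, f = ∑ i, c i * X i := by
  have h := mem_span_X_image Finset.univ f fun α hα => by
    obtain rfl : α = 0 := by
      ext i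
      exact hα i (Finset.mem_univ i)
    simpa using hf
  rw [Finset.coe_univ, Set.image_univ, Ideal.mem_span_range_iff_exists_fun] at h
  obtain ⟨c, hc⟩ := h
  exact ⟨c, hc.symm⟩

theorem coeff_single_one_mul {σ R : Type*} [CommRing R] (j : σ) (f g : MvPowerSeries σ R)
    (hg : constantCoeff g = 0) :
    coeff (Finsupp.single j 1) (f * g) = constantCoeff f * coeff (Finsupp.single j 1) g := by
  classical
  rw [coeff_mul, Finsupp.antidiagonal_single]
  simp [Finset.Nat.antidiagonal_succ, hg]

/-- The linear part of a surjective algebra endomorphism of a power series algebra fixing the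
origin is invertible. -/
theorem isUnit_det_linearPart {σ K : Type*} [Fintype σ] [DecidableEq σ] [CommRing K]
    (ψ : MvPowerSeries σ K →ₐ[K] MvPowerSeries σ K) (hψ : Function.Surjective ψ)
    (hX : ∀ i, constantCoeff (ψ (X i)) = 0) :
    IsUnit (Matrix.of fun i j => coeff (Finsupp.single j 1) (ψ (X i))).det := by
  have hmax (f : MvPowerSeries σ K) (hf : constantCoeff f = 0) : constantCoeff (ψ f) = 0 := by
    obtain ⟨c, rfl⟩ := exists_eq_sum_mul_X f hf
    simp [hX]
  have hC (a : K) : ψ (C a) = C a := ψ.commutes a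
  have hconst (f : MvPowerSeries σ K) : constantCoeff (ψ f) = constantCoeff f := by
    have h := hmax (f - C (constantCoeff f)) (by simp)
    rwa [map_sub, hC, map_sub, constantCoeff_C, sub_eq_zero] at h
  choose g hg using fun j => hψ (X j)
  have hg0 (j : σ) : constantCoeff (g j) = 0 := by
    rw [← hconst, hg, constantCoeff_X]
  choose c hc using fun j => exists_eq_sum_mul_X (g j) (hg0 j)
  refine Matrix.isUnit_det_of_left_inverse (B := Matrix.of fun j i => constantCoeff (c j i)) ?_
  ext j l
  have h : coeff (Finsupp.single l 1) (ψ (g j)) =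
      ∑ i, constantCoeff (c j i) * coeff (Finsupp.single l 1) (ψ (X i)) := by
    rw [hc j, map_sum, map_sum]
    refine Finset.sum_congr rfl fun i _ => ?_
    rw [map_mul, coeff_single_one_mul _ _ _ (hX i), hconst]
  rw [Matrix.mul_apply, Matrix.one_apply]
  simp only [Matrix.of_apply]
  rw [← h, hg, coeff_X]
  simp [Finsupp.single_left_inj, eq_comm]

end MvPowerSeries

/-- A polynomial matrix which is block triangular with respect to `w`, with constant diagonal
blocks, has constant determinant. -/
theorem Matrix.det_eq_C_of_weight {ι K : Type*} [Fintype ι] [DecidableEq ι] [CommRing K]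
    (w : ι → ℕ) (p : Matrix ι ι (Polynomial K))
    (hlt : ∀ i j, w j < w i → p i j = 0)
    (heq : ∀ i j, w j = w i → p i j = Polynomial.C ((p i j).coeff 0)) :
    p.det = Polynomial.C (Matrix.of fun i j => (p i j).coeff 0).det := by
  have hprod (σ : Equiv.Perm ι) :
      ∏ i, p (σ i) i = ∏ i, Polynomial.C ((p (σ i) i).coeff 0) := by
    by_cases h : ∃ i, w i < w (σ i)
    · obtain ⟨i, hi⟩ := h
      have hC : Polynomial.C ((p (σ i) i).coeff 0) = 0 := by simp [hlt _ _ hi]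
      rw [Finset.prod_eq_zero (f := fun i => p (σ i) i) (Finset.mem_univ i) (hlt _ _ hi),
        Finset.prod_eq_zero (f := fun i => Polynomial.C ((p (σ i) i).coeff 0))
          (Finset.mem_univ i) hC]
    · push Not at h
      have hsum : ∑ i, w (σ i) = ∑ i, w i := Equiv.sum_comp σ w
      have hw := (Finset.sum_eq_sum_iff_of_le fun i _ => h i).mp hsum
      exact Finset.prod_congr rfl fun i hi => heq _ _ (hw i hi).symm
  rw [Matrix.det_apply', Matrix.det_apply', map_sum]
  refine Finset.sum_congr rfl fun σ _ => ?_
  rw [hprod, map_mul, map_prod, map_intCast]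
  rfl

namespace PowerSeries

/-- Setting the variable to zero in an algebra automorphism of `R⟦X⟧` fixing `X`. -/
noncomputable def constantCoeffAlgHom {K R : Type*} [CommRing K] [CommRing R] [Algebra K R]
    (φ : PowerSeries R ≃ₐ[K] PowerSeries R) : R →ₐ[K] R where
  __ := (constantCoeff (R := R)).comp ((φ : PowerSeries R →+* PowerSeries R).comp C)
  commutes' a := by
    have h : C (algebraMap K R a) = algebraMap K (PowerSeries R) a := by
      rw [algebraMap_apply]
    change constantCoeff (φ (C (algebraMap K R a))) = algebraMap K R a
    rw [h, φ.commutes, algebraMap_apply, constantCoeff_C]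

theorem constantCoeffAlgHom_apply {K R : Type*} [CommRing K] [CommRing R] [Algebra K R]
    (φ : PowerSeries R ≃ₐ[K] PowerSeries R) (f : R) :
    constantCoeffAlgHom φ f = coeff 0 (φ (C f)) := by
  simp [constantCoeffAlgHom]

theorem constantCoeffAlgHom_surjective {K R : Type*} [CommRing K] [CommRing R] [Algebra K R]
    (φ : PowerSeries R ≃ₐ[K] PowerSeries R) (hφ : φ X = X) :
    Function.Surjective (constantCoeffAlgHom φ) := by
  intro g
  obtain ⟨F, hF⟩ := φ.surjective (C g)
  refine ⟨constantCoeff F, ?_⟩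
  rw [constantCoeffAlgHom_apply]
  rw [eq_X_mul_shift_add_const F, map_add, map_mul, hφ] at hF
  simpa using congrArg constantCoeff hF

end PowerSeries

/-- **Weighted sufficient condition for a formal isotopy to be evaluative.**
Let `K` be a field of characteristic zero, `R = MvPowerSeries (Fin n) K`, `w` a weighting
of `K^n`, and `φ` a formal isotopy with components `φ^{k,i} = coeff_k (φ (C x^i))`.
If `Θ_w(φ^{0,i}) ≥ w i`, `Θ_w(φ^{k,i}) ≥ w i + 1` for `k ≥ 1`, and the (unweighted)
orders of the `φ^{k,·}` tend to infinity, then `φ` is evaluative: each `x^α`-coefficient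
of each component is nonzero for only finitely many `k`, each component has vanishing
constant coefficient, and the polynomial matrix of linear parts has determinant a
nonzero constant polynomial. -/
theorem evaluative_isotopy_weighted_condition
    (K : Type*) [Field K] [CharZero K] (n : ℕ)
    (w : Fin n → ℕ) (hw1 : ∀ i, 1 ≤ w i) (hwmono : Monotone w)
    (φ : PowerSeries (MvPowerSeries (Fin n) K) ≃ₐ[K]
          PowerSeries (MvPowerSeries (Fin n) K))
    (hφX : φ PowerSeries.X = PowerSeries.X)
    (comp : ℕ → Fin n → MvPowerSeries (Fin n) K)
    (hcomp : ∀ (k : ℕ) (i : Fin n), comp k i =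
      PowerSeries.coeff k
        (φ (PowerSeries.C (MvPowerSeries.X i))))
    (h0 : ∀ (i : Fin n) (α : Fin n →₀ ℕ), (∑ j, w j * α j) < w i →
      MvPowerSeries.coeff α (comp 0 i) = 0)
    (h1 : ∀ k : ℕ, 1 ≤ k → ∀ (i : Fin n) (α : Fin n →₀ ℕ),
      (∑ j, w j * α j) < w i + 1 → MvPowerSeries.coeff α (comp k i) = 0)
    (hlim : ∀ N : ℕ, ∃ K₀ : ℕ, ∀ k : ℕ, K₀ ≤ k → ∀ (i : Fin n) (α : Fin n →₀ ℕ),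
      (∑ j, α j) < N → MvPowerSeries.coeff α (comp k i) = 0) :
    (∀ (i : Fin n) (α : Fin n →₀ ℕ),
      {k : ℕ | MvPowerSeries.coeff α (comp k i) ≠ 0}.Finite) ∧
    (∀ (k : ℕ) (i : Fin n), MvPowerSeries.constantCoeff (comp k i) = 0) ∧
    (∃ p : Matrix (Fin n) (Fin n) (Polynomial K),
      (∀ (i j : Fin n) (k : ℕ),
        (p i j).coeff k = MvPowerSeries.coeff (Finsupp.single j 1) (comp k i)) ∧
      ∃ c : K, c ≠ 0 ∧ p.det = Polynomial.C c) := by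
  have hweight (j : Fin n) : ∑ l, w l * (Finsupp.single j 1 : Fin n →₀ ℕ) l = w j := by
    simp [Finsupp.single_apply]
  have hfin (i : Fin n) (α : Fin n →₀ ℕ) :
      {k : ℕ | MvPowerSeries.coeff α (comp k i) ≠ 0}.Finite := by
    obtain ⟨K₀, hK₀⟩ := hlim (∑ j, α j + 1)
    refine (Set.finite_lt_nat K₀).subset fun k hk => ?_
    by_contra h
    exact hk (hK₀ k (not_lt.mp h) i α (Nat.lt_succ_self _))
  have hconst (k : ℕ) (i : Fin n) : MvPowerSeries.constantCoeff (comp k i) = 0 := by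
    rw [← MvPowerSeries.coeff_zero_eq_constantCoeff_apply]
    rcases Nat.eq_zero_or_pos k with rfl | hk
    · exact h0 i 0 (by simpa using Nat.lt_of_succ_le (hw1 i))
    · exact h1 k hk i 0 (by simp)
  refine ⟨hfin, hconst, ?_⟩
  let p : Matrix (Fin n) (Fin n) (Polynomial K) := Matrix.of fun i j =>
    ∑ k ∈ (hfin i (Finsupp.single j 1)).toFinset,
      Polynomial.monomial k (MvPowerSeries.coeff (Finsupp.single j 1) (comp k i))
  have hp (i j : Fin n) (k : ℕ) :
      (p i j).coeff k = MvPowerSeries.coeff (Finsupp.single j 1) (comp k i) := by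
    simp only [p, Matrix.of_apply, Polynomial.finsetSum_coeff, Polynomial.coeff_monomial,
      Finset.sum_ite_eq', ite_eq_left_iff]
    intro h
    simpa [eq_comm] using h
  refine ⟨p, hp, (Matrix.of fun i j => (p i j).coeff 0).det, ?_,
    Matrix.det_eq_C_of_weight w p (fun i j hij => ?_) (fun i j hij => ?_)⟩
  · have h := MvPowerSeries.isUnit_det_linearPart (PowerSeries.constantCoeffAlgHom φ)
      (PowerSeries.constantCoeffAlgHom_surjective φ hφX)
      (fun i => by rw [PowerSeries.constantCoeffAlgHom_apply, ← hcomp, hconst])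
    simp only [PowerSeries.constantCoeffAlgHom_apply, ← hcomp, ← hp] at h
    exact h.ne_zero
  · ext k
    rw [hp, Polynomial.coeff_zero]
    rcases Nat.eq_zero_or_pos k with rfl | hk
    · exact h0 i _ (by rwa [hweight])
    · exact h1 k hk i _ (by rw [hweight]; omega)
  · ext k
    rw [Polynomial.coeff_C]
    split_ifs with hk
    · rw [hk]
    · rw [hp]
      exact h1 k (Nat.one_le_iff_ne_zero.mpr hk) i _ (by rw [hweight]; omega)
end

section
/- Let K be a field of characteristic zero, R = MvPowerSeries (Fin n) K, w a weighting of K^n, and D a time-dependent formal vector field with components X^{k,i} := coeff_k(D(C(x^i))) ∈ R. Suppose that for all k ∈ ℕ and all i, coeff_α(X^{k,i}) = 0 whenever ⟨w,α⟩ < w i + k + 1 (i.e. D's k-th Taylor coefficient raises weighted filtration degree by at least k+1). Let φ be a formal isotopy satisfying the initial condition (IC) and the flow property (FP) for D, with components φ^{k,i} := coeff_k(φ(C(x^i))). Then for all k ∈ ℕ and all i, coeff_α(φ^{k,i}) = 0 whenever ⟨w,α⟩ < w i + k. -/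
namespace MvPowerSeries

section WeightedFiltration

variable {σ K : Type*} [Field K]

/-- The subspace of power series all of whose monomials have `w`-weight at least `N`. -/
def weightedFiltration (K : Type*) [Field K] (w : σ → ℕ) (N : ℕ) :
    Submodule K (MvPowerSeries σ K) where
  carrier := {f | (N : ℕ∞) ≤ f.weightedOrder w}
  add_mem' hf hg := (le_min hf hg).trans (min_weightedOrder_le_add w)
  zero_mem' := by simp
  smul_mem' _ _ hf := le_trans hf (le_weightedOrder_smul w)

variable {w : σ → ℕ} {M N : ℕ} {f g : MvPowerSeries σ K}

theorem mem_weightedFiltration :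
    f ∈ weightedFiltration K w N ↔ ∀ α, Finsupp.weight w α < N → coeff α f = 0 :=
  ⟨fun hf _ hα => coeff_eq_zero_of_lt_weightedOrder w (lt_of_lt_of_le (mod_cast hα) hf),
    nat_le_weightedOrder w⟩

theorem mem_weightedFiltration_iff_sum [Fintype σ] :
    f ∈ weightedFiltration K w N ↔ ∀ α : σ →₀ ℕ, ∑ j, w j * α j < N → coeff α f = 0 := by
  simp only [mem_weightedFiltration, Finsupp.weight_eq_sum, smul_eq_mul, mul_comm]

theorem mem_weightedFiltration_zero (f : MvPowerSeries σ K) : f ∈ weightedFiltration K w 0 :=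
  mem_weightedFiltration.2 fun _ h => absurd h (Nat.not_lt_zero _)

theorem mul_mem_weightedFiltration (hf : f ∈ weightedFiltration K w M)
    (hg : g ∈ weightedFiltration K w N) : f * g ∈ weightedFiltration K w (M + N) := by
  change ((M + N : ℕ) : ℕ∞) ≤ _
  push_cast
  exact (add_le_add hf hg).trans (le_weightedOrder_mul w)

theorem weightedFiltration_antitone : Antitone (weightedFiltration K w) :=
  fun _ _ h _ hf => (Nat.cast_le (α := ℕ∞).2 h).trans hf

theorem X_mem_weightedFiltration (i : σ) :
    (X i : MvPowerSeries σ K) ∈ weightedFiltration K w (w i) := by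
  classical
  refine mem_weightedFiltration.2 fun α hα => ?_
  rw [coeff_X, if_neg]
  rintro rfl
  simp [Finsupp.weight_single] at hα

/-- Euler's formula, divided by the total degree in each coefficient. -/
theorem exists_eq_C_add_sum_X_mul [CharZero K] [Fintype σ] (f : MvPowerSeries σ K) :
    ∃ r : σ → MvPowerSeries σ K, f = C (constantCoeff f) + ∑ i, X i * r i ∧
      ∀ N, f ∈ weightedFiltration K w N → ∀ i, r i ∈ weightedFiltration K w (N - w i) := by
  classical
  let r (i : σ) : MvPowerSeries σ K := fun β =>
    ((β i : K) + 1) / ((β.degree : K) + 1) * coeff (β + Finsupp.single i 1) f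
  have coeff_r (i : σ) (β : σ →₀ ℕ) : coeff β (r i) =
      ((β i : K) + 1) / ((β.degree : K) + 1) * coeff (β + Finsupp.single i 1) f := rfl
  refine ⟨r, ?_, fun N hf i => mem_weightedFiltration.2 fun β hβ => ?_⟩
  · ext α
    have key (i : σ) : coeff α (X i * r i) = α i / α.degree * coeff α f := by
      rw [MvPowerSeries.X, coeff_monomial_mul]
      split_ifs with h
      · obtain ⟨β, rfl⟩ := exists_add_of_le h
        rw [add_tsub_cancel_left, one_mul]
        simp [coeff_r, add_comm]
      · have : α i = 0 := by simpa [Finsupp.single_le_iff] using h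
        simp [this]
    rw [map_add, map_sum, Finset.sum_congr rfl fun i _ => key i, ← Finset.sum_mul,
      ← Finset.sum_div, ← Nat.cast_sum, ← Finsupp.degree_eq_sum, coeff_C]
    split_ifs with h
    · simp [h]
    · rw [div_self (Nat.cast_ne_zero.2 (mt (Finsupp.degree_eq_zero_iff α).1 h)), one_mul, zero_add]
  · have : Finsupp.weight w (β + Finsupp.single i 1) < N := by
      simp only [map_add, Finsupp.weight_single, smul_eq_mul]
      omega
    exact mul_eq_zero_of_right _ (mem_weightedFiltration.1 hf _ this)

end WeightedFiltration

end MvPowerSeries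

open MvPowerSeries in
/-- A derivation of the power series ring that raises the weight of each variable by `s` raises
weighted filtration degree by `s`; no continuity is assumed. -/
theorem Derivation.apply_mem_weightedFiltration {σ K : Type*} [Field K] [CharZero K] [Fintype σ]
    {w : σ → ℕ} (hw : ∀ i, 1 ≤ w i) (d : Derivation K (MvPowerSeries σ K) (MvPowerSeries σ K))
    {s : ℕ} (hd : ∀ i, d (X i) ∈ weightedFiltration K w (w i + s)) {N : ℕ}
    {f : MvPowerSeries σ K} (hf : f ∈ weightedFiltration K w N) :
    d f ∈ weightedFiltration K w (N + s) := by
  have map_C (c : K) : d (C c) = 0 := d.map_algebraMap c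
  have base (e : ℕ) (he : e ≤ s) : ∀ g, d g ∈ weightedFiltration K w e := by
    induction e with
    | zero => exact fun g => mem_weightedFiltration_zero _
    | succ e ih =>
      intro g
      obtain ⟨r, hr, -⟩ := exists_eq_C_add_sum_X_mul (w := w) g
      rw [hr, map_add, map_C, zero_add, map_sum]
      refine Submodule.sum_mem _ fun i _ => ?_
      rw [Derivation.leibniz, smul_eq_mul, smul_eq_mul]
      have hwi := hw i
      exact add_mem
        (weightedFiltration_antitone (by omega)
          (mul_mem_weightedFiltration (X_mem_weightedFiltration i) (ih (by omega) (r i))))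
        (weightedFiltration_antitone (by omega)
          (mul_mem_weightedFiltration (mem_weightedFiltration_zero (r i)) (hd i)))
  induction N using Nat.strong_induction_on generalizing f with
  | _ N ih =>
    obtain rfl | hN := Nat.eq_zero_or_pos N
    · simpa using base s le_rfl f
    obtain ⟨r, hr, hrN⟩ := exists_eq_C_add_sum_X_mul (w := w) f
    rw [hr, map_add, map_C, zero_add, map_sum]
    refine Submodule.sum_mem _ fun i _ => ?_
    rw [Derivation.leibniz, smul_eq_mul, smul_eq_mul]
    have hwi := hw i
    exact add_mem
      (weightedFiltration_antitone (by omega)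
        (mul_mem_weightedFiltration (X_mem_weightedFiltration i)
          (ih (N - w i) (by omega) (hrN N hf i))))
      (weightedFiltration_antitone (by omega)
        (mul_mem_weightedFiltration (hrN N hf i) (hd i)))

namespace PowerSeries

variable {K R : Type*} [CommSemiring K] [CommRing R] [Algebra K R]

/-- The `k`-th Taylor coefficient of a time-dependent derivation, as a derivation of the
coefficient ring. -/
noncomputable def coeffDerivation (D : Derivation K (PowerSeries R) (PowerSeries R)) (k : ℕ) :
    Derivation K R R :=
  Derivation.mk'
    { toFun f := coeff k (D (C f))
      map_add' f g := by simp
      map_smul' c f := by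
        have : C (c • f) = c • (C f : PowerSeries R) := by
          ext m
          simp [coeff_C]
        rw [this, D.map_smul]
        simp }
    fun f g => by
      change coeff k (D (C (f * g))) = f * coeff k (D (C g)) + g * coeff k (D (C f))
      rw [map_mul, Derivation.leibniz, map_add, smul_eq_mul, smul_eq_mul, coeff_C_mul,
        coeff_C_mul]

theorem coeffDerivation_apply (D : Derivation K (PowerSeries R) (PowerSeries R)) (k : ℕ)
    (f : R) : coeffDerivation D k f = coeff k (D (C f)) :=
  rfl

/-- A ring endomorphism fixing `X` is determined coefficientwise by its values on constants. -/
theorem coeff_map_eq_sum (φ : PowerSeries R →+* PowerSeries R) (hφ : φ X = X) (k : ℕ)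
    (s : PowerSeries R) :
    coeff k (φ s) = ∑ j ∈ Finset.range (k + 1), coeff (k - j) (φ (C (coeff j s))) := by
  induction k generalizing s with
  | zero =>
    conv_lhs => rw [eq_shift_mul_X_add_const s, map_add, map_mul, hφ]
    simp
  | succ k ih =>
    conv_lhs => rw [eq_shift_mul_X_add_const s, map_add, map_mul, hφ, map_add, coeff_succ_mul_X, ih]
    rw [Finset.sum_range_succ' _ (k + 1)]
    simp

end PowerSeries


/-- **Weighted order estimate for flows.**
Let `K` be a field of characteristic zero, `R = MvPowerSeries (Fin n) K`, `w` a weighting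
of `K^n`, and `D` a time-dependent formal vector field whose `k`-th Taylor components
`X^{k,i} = coeff_k (D (C x^i))` satisfy `Θ_w(X^{k,i}) ≥ w i + k + 1` for all `k, i`.
If `φ` is a formal isotopy satisfying the initial condition and flow property for `D`,
then its components `φ^{k,i} = coeff_k (φ (C x^i))` satisfy `Θ_w(φ^{k,i}) ≥ w i + k`. -/
theorem evaluative_flow_weighted_condition
    (K : Type*) [Field K] [CharZero K] (n : ℕ)
    (w : Fin n → ℕ) (hw1 : ∀ i, 1 ≤ w i) (hwmono : Monotone w)
    (D : Derivation K (PowerSeries (MvPowerSeries (Fin n) K))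
          (PowerSeries (MvPowerSeries (Fin n) K)))
    (hD : D PowerSeries.X = 0)
    (hDord : ∀ (k : ℕ) (i : Fin n) (α : Fin n →₀ ℕ),
      (∑ j, w j * α j) < w i + k + 1 →
      MvPowerSeries.coeff (R := K) α
        (PowerSeries.coeff (R := MvPowerSeries (Fin n) K) k
          (D (PowerSeries.C (R := MvPowerSeries (Fin n) K) (MvPowerSeries.X i)))) = 0)
    (φ : PowerSeries (MvPowerSeries (Fin n) K) ≃ₐ[K]
          PowerSeries (MvPowerSeries (Fin n) K))
    (hφX : φ PowerSeries.X = PowerSeries.X)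
    (hIC : ∀ f : MvPowerSeries (Fin n) K,
      PowerSeries.coeff (R := MvPowerSeries (Fin n) K) 0
        (φ (PowerSeries.C (R := MvPowerSeries (Fin n) K) f)) = f)
    (hFP : ∀ f : MvPowerSeries (Fin n) K,
      PowerSeries.derivative (MvPowerSeries (Fin n) K)
          (φ (PowerSeries.C (R := MvPowerSeries (Fin n) K) f)) =
        φ (D (PowerSeries.C (R := MvPowerSeries (Fin n) K) f))) :
    ∀ (k : ℕ) (i : Fin n) (α : Fin n →₀ ℕ),
      (∑ j, w j * α j) < w i + k →
      MvPowerSeries.coeff (R := K) α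
        (PowerSeries.coeff (R := MvPowerSeries (Fin n) K) k
          (φ (PowerSeries.C (R := MvPowerSeries (Fin n) K) (MvPowerSeries.X i)))) = 0 := by
  have flow (k : ℕ) : ∀ (N : ℕ) (f : MvPowerSeries (Fin n) K),
      f ∈ MvPowerSeries.weightedFiltration K w N →
      PowerSeries.coeff k (φ (PowerSeries.C f)) ∈
        MvPowerSeries.weightedFiltration K w (N + k) := by
    induction k using Nat.strong_induction_on with
    | _ k ih =>
      intro N f hf
      cases k with
      | zero => simpa only [hIC, add_zero] using hf
      | succ k =>
        have step : PowerSeries.coeff (k + 1) (φ (PowerSeries.C f)) * ((k : _) + 1) =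
            ∑ j ∈ Finset.range (k + 1), PowerSeries.coeff (k - j)
              (φ (PowerSeries.C (PowerSeries.coeffDerivation D j f))) := by
          rw [← PowerSeries.coeff_derivative, hFP]
          exact PowerSeries.coeff_map_eq_sum
            (φ : PowerSeries (MvPowerSeries (Fin n) K) →+* PowerSeries (MvPowerSeries (Fin n) K)) hφX k _
        have hk : (k : K) + 1 ≠ 0 := Nat.cast_add_one_ne_zero k
        have smul_eq : ((k : K) + 1) • PowerSeries.coeff (k + 1) (φ (PowerSeries.C f)) =
            PowerSeries.coeff (k + 1) (φ (PowerSeries.C f)) * ((k : _) + 1) := by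
          rw [Algebra.smul_def, mul_comm]
          simp
        rw [← Submodule.smul_mem_iff _ hk, smul_eq, step]
        refine Submodule.sum_mem _ fun j hj => ?_
        have hjk : j < k + 1 := Finset.mem_range.1 hj
        have hDf : PowerSeries.coeffDerivation D j f ∈
            MvPowerSeries.weightedFiltration K w (N + (j + 1)) :=
          Derivation.apply_mem_weightedFiltration hw1 _
            (fun i => MvPowerSeries.mem_weightedFiltration_iff_sum.2 (hDord j i)) hf
        exact MvPowerSeries.weightedFiltration_antitone (by omega) (ih (k - j) (by omega) _ _ hDf)
  exact fun k i => MvPowerSeries.mem_weightedFiltration_iff_sum.1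
    (flow k (w i) _ (MvPowerSeries.X_mem_weightedFiltration i))
end
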